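/- arXiv:1506.06450 — 3 statements merged into one kernel-verified Lean document; each statement's English description precedes it below -/
import Mathlib

section
/- Let G be a finite group. If acd_{2'}(G) < 3/2, then G has a normal 2-complement. -/
open Module CategoryTheory

noncomputable section

/-- `χ : G → ℂ` is the character of an irreducible complex representation of `G`
of degree `d`. -/
def IsIrrCharDeg (G : Type) [Group G] (χ : G → ℂ) (d : ℕ) : Prop :=
  ∃ V : FDRep ℂ G, Simple V ∧ χ = FDRep.character V ∧ finrank ℂ V = d

/-- `χ : G → ℂ` is an irreducible complex character of `G`. -/
def IsIrrChar (G : Type) [Group G] (χ : G → ℂ) : Prop :=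
  ∃ d, IsIrrCharDeg G χ d

/-- The set of irreducible complex characters of `G` whose degree is not divisible by `p`. -/
def IrrP' (p : ℕ) (G : Type) [Group G] : Set (G → ℂ) :=
  {χ | ∃ d, IsIrrCharDeg G χ d ∧ ¬ p ∣ d}

/-- `acd_{p'}(G)`: the average of the degrees of the irreducible complex characters of `G`
whose degree is not divisible by `p`.  (For a character `χ`, its degree equals `χ 1`,
a nonnegative real.) -/
def acdP' (p : ℕ) (G : Type) [Group G] : ℝ :=
  (∑ᶠ χ ∈ IrrP' p G, (χ 1).re) / (IrrP' p G).ncard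

abbrev MRep (G : Type) [Group G] (d : ℕ) := G →* Matrix (Fin d) (Fin d) ℂ

def chr {G : Type} [Group G] {d : ℕ} (ρ : MRep G d) : G → ℂ := fun g => (ρ g).trace

def MIrr {G : Type} [Group G] {d : ℕ} (ρ : MRep G d) : Prop :=
  0 < d ∧ ∀ M : Matrix (Fin d) (Fin d) ℂ, (∀ g, M * ρ g = ρ g * M) → ∃ c : ℂ, M = c • 1

def toRepn {G : Type} [Group G] {d : ℕ} (ρ : MRep G d) : Representation ℂ G (Fin d → ℂ) :=
  (Matrix.toLinAlgEquiv' : Matrix (Fin d) (Fin d) ℂ ≃ₐ[ℂ] _).toAlgHom.toMonoidHom.comp ρ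

theorem toRepn_apply {G : Type} [Group G] {d : ℕ} (ρ : MRep G d) (g : G) :
    toRepn ρ g = Matrix.toLin' (ρ g) := rfl

def toF {G : Type} [Group G] {d : ℕ} (ρ : MRep G d) : FDRep ℂ G := FDRep.of (toRepn ρ)

theorem toF_char {G : Type} [Group G] {d : ℕ} (ρ : MRep G d) :
    (toF ρ).character = chr ρ := by
  ext g
  change LinearMap.trace ℂ (Fin d → ℂ) (Matrix.toLin' (ρ g)) = _
  rw [Matrix.trace_toLin'_eq]; rfl

theorem toRepn_char {G : Type} [Group G] {d : ℕ} (ρ : MRep G d) :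
    (toRepn ρ).character = chr ρ := toF_char ρ

theorem chr_one {G : Type} [Group G] {d : ℕ} (ρ : MRep G d) : chr ρ 1 = d := by
  simp [chr]

theorem norm_of_MIrr {G : Type} [Group G] [Fintype G] {d : ℕ} {ρ : MRep G d} (h : MIrr ρ) :
    ∑ g : G, chr ρ g * chr ρ g⁻¹ = Nat.card G := by
  have hc : (Nat.card G : ℂ) ≠ 0 := by exact_mod_cast Nat.card_pos.ne'
  letI := invertibleOfNonzero hc
  have key := Representation.card_inv_mul_sum_char_mul_char_eq_finrank (toRepn ρ) (toRepn ρ)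
  haveI : NeZero d := ⟨h.1.ne'⟩
  have h1 : finrank ℂ (Representation.IntertwiningMap (toRepn ρ) (toRepn ρ)) = 1 := by
    refine finrank_eq_one (1 : Representation.IntertwiningMap (toRepn ρ) (toRepn ρ)) ?_ ?_
    · intro h0
      have := congrArg (fun f : Representation.IntertwiningMap (toRepn ρ) (toRepn ρ) =>
        f (fun _ => (1:ℂ)) 0) h0
      simp at this
    · intro f
      obtain ⟨c, hc⟩ := h.2 (LinearMap.toMatrix' f.toLinearMap) (by
        intro g
        have := f.isIntertwining' g
        have := congrArg LinearMap.toMatrix' this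
        simpa [toRepn_apply, LinearMap.toMatrix'_comp] using this)
      refine ⟨c, ?_⟩
      apply Representation.IntertwiningMap.ext
      apply LinearMap.toMatrix'.injective
      rw [hc]
      have : (c • (1 : Representation.IntertwiningMap (toRepn ρ) (toRepn ρ))).toLinearMap = c • LinearMap.id := rfl
      rw [this]; simp
  rw [h1, toRepn_char] at key
  field_simp at key
  simpa using key

theorem MIrr_of_norm {G : Type} [Group G] [Fintype G] {d : ℕ} {ρ : MRep G d}
    (h : ∑ g : G, chr ρ g * chr ρ g⁻¹ = Nat.card G) : MIrr ρ := by
  have hc : (Nat.card G : ℂ) ≠ 0 := by exact_mod_cast Nat.card_pos.ne'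
  letI := invertibleOfNonzero hc
  have key := Representation.card_inv_mul_sum_char_mul_char_eq_finrank (toRepn ρ) (toRepn ρ)
  rw [toRepn_char, h, inv_mul_cancel₀ hc] at key
  have key1 : finrank ℂ (Representation.IntertwiningMap (toRepn ρ) (toRepn ρ)) = 1 := by
    exact_mod_cast key.symm
  have hd : 0 < d := by
    rcases Nat.eq_zero_or_pos d with rfl | h0
    · exfalso
      have h2 : ∀ g, chr ρ g = 0 := fun g => by simp [chr, Matrix.trace]
      simp only [h2, mul_zero, Finset.sum_const_zero] at h
      exact hc h.symm
    · exact h0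
  haveI : NeZero d := ⟨hd.ne'⟩
  refine ⟨hd, fun M hM => ?_⟩
  have hne : (1 : Representation.IntertwiningMap (toRepn ρ) (toRepn ρ)) ≠ 0 := by
    intro h0
    have := congrArg (fun f : Representation.IntertwiningMap (toRepn ρ) (toRepn ρ) =>
        f (fun _ => (1:ℂ)) 0) h0
    simp at this
  let f : Representation.IntertwiningMap (toRepn ρ) (toRepn ρ) :=
    ⟨Matrix.toLin' M, fun g => by
      rw [toRepn_apply, ← Matrix.toLin'_mul, ← Matrix.toLin'_mul, hM]⟩
  obtain ⟨c, hc⟩ := (finrank_eq_one_iff_of_nonzero' _ hne).1 key1 f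
  refine ⟨c, ?_⟩
  apply Matrix.toLin'.injective
  have : Matrix.toLin' M = c • LinearMap.id := by
    change f.toLinearMap = _
    rw [← hc]; rfl
  rw [this]; simp

theorem simple_toF {G : Type} [Group G] [Finite G] {d : ℕ} {ρ : MRep G d} (h : MIrr ρ) :
    Simple (toF ρ) := by
  haveI := Fintype.ofFinite G
  rw [FDRep.simple_iff_char_is_norm_one, toF_char]
  exact norm_of_MIrr h

theorem irrchar_iff {G : Type} [Group G] [Finite G] {d : ℕ} {χ : G → ℂ} :
    IsIrrCharDeg G χ d ↔ ∃ ρ : MRep G d, MIrr ρ ∧ χ = chr ρ := by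
  haveI := Fintype.ofFinite G
  constructor
  · rintro ⟨V, hV, rfl, hd⟩
    let b := Module.finBasisOfFinrankEq ℂ V hd
    let ρ : MRep G d := (LinearMap.toMatrixAlgEquiv b).toAlgHom.toMonoidHom.comp V.ρ
    have hc : FDRep.character V = chr ρ := by
      ext g
      change LinearMap.trace ℂ V (V.ρ g) = (LinearMap.toMatrix b b (V.ρ g)).trace
      rw [LinearMap.trace_eq_matrix_trace ℂ b]
    refine ⟨ρ, ?_, hc⟩
    apply MIrr_of_norm
    rw [← hc]
    exact (FDRep.simple_iff_char_is_norm_one V).1 hV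
  · rintro ⟨ρ, h, rfl⟩
    exact ⟨toF ρ, simple_toF h, (toF_char ρ).symm, by
      change finrank ℂ (Fin d → ℂ) = d
      simp⟩

theorem orth {G : Type} [Group G] [Fintype G] {d e : ℕ} {ρ : MRep G d} {σ : MRep G e}
    (h : MIrr ρ) (h' : MIrr σ) (hne : chr ρ ≠ chr σ) : ∑ g : G, chr ρ g * chr σ g⁻¹ = 0 := by
  have hc : (Nat.card G : ℂ) ≠ 0 := by exact_mod_cast Nat.card_pos.ne'
  letI := invertibleOfNonzero hc
  haveI := simple_toF h
  haveI := simple_toF h'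
  have := FDRep.char_orthonormal (toF ρ) (toF σ)
  rw [toF_char, toF_char, if_neg] at this
  · simpa [hc] using this
  · rintro ⟨i⟩
    exact hne (by rw [← toF_char, ← toF_char, FDRep.char_iso i])

theorem exists_intertwiner {G : Type} [Group G] [Finite G] {d : ℕ} {ρ σ : MRep G d}
    (h : MIrr ρ) (h' : MIrr σ) (heq : chr ρ = chr σ) :
    ∃ T : Matrix (Fin d) (Fin d) ℂ, IsUnit T.det ∧ ∀ g, T * ρ g = σ g * T := by
  haveI := Fintype.ofFinite G
  have hc : (Nat.card G : ℂ) ≠ 0 := by exact_mod_cast Nat.card_pos.ne'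
  letI := invertibleOfNonzero hc
  haveI := simple_toF h
  haveI := simple_toF h'
  have key := FDRep.char_orthonormal (toF ρ) (toF σ)
  rw [toF_char, toF_char, ← heq, norm_of_MIrr h, inv_mul_cancel₀ hc] at key
  have hn : Nonempty (toF ρ ≅ toF σ) := by
    by_contra hcon
    rw [if_neg hcon] at key
    exact one_ne_zero key
  obtain ⟨i⟩ := hn
  let e : (Fin d → ℂ) ≃ₗ[ℂ] (Fin d → ℂ) := FDRep.isoToLinearEquiv i
  have he : ∀ g, (toRepn σ g) = e.conj (toRepn ρ g) := fun g => FDRep.Iso.conj_ρ i g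
  refine ⟨LinearMap.toMatrix' e.toLinearMap, ?_, fun g => ?_⟩
  · rw [LinearMap.det_toMatrix']
    exact e.isUnit_det'
  · have h2 : e.toLinearMap ∘ₗ toRepn ρ g = toRepn σ g ∘ₗ e.toLinearMap := by
      rw [he]; ext; simp [LinearEquiv.conj_apply]
    have := congrArg LinearMap.toMatrix' h2
    simpa [toRepn_apply, LinearMap.toMatrix'_comp] using this

theorem scalar_of_comm {d : ℕ} (M : Matrix (Fin d) (Fin d) ℂ) (h : ∀ A, M * A = A * M) :
    ∃ c : ℂ, M = c • 1 := by
  have : M ∈ Set.range (Matrix.scalar (Fin d)) := by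
    rw [Matrix.mem_range_scalar_iff_commute_single]
    intro i j _
    exact (h _).symm
  obtain ⟨c, rfl⟩ := this
  exact ⟨c, by simp [Matrix.smul_one_eq_diagonal]⟩

theorem wed (N : Type) [Group N] [Finite N] :
    ∃ (n : ℕ) (d : Fin n → ℕ) (ρ : ∀ i, MRep N (d i)), (∀ i, MIrr (ρ i)) ∧
      Function.Injective (fun i => chr (ρ i)) ∧
      (∀ (e : ℕ) (σ : MRep N e), MIrr σ → ∃ i, chr σ = chr (ρ i)) ∧
      ∑ i, d i ^ 2 = Nat.card N := by
  haveI := Fintype.ofFinite N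
  haveI : NeZero (Nat.card N : ℂ) := ⟨by exact_mod_cast Nat.card_pos.ne'⟩
  haveI : FiniteDimensional ℂ (MonoidAlgebra ℂ N) :=
    Module.Finite.equiv (MonoidAlgebra.coeffLinearEquiv ℂ : MonoidAlgebra ℂ N ≃ₗ[ℂ] (N →₀ ℂ)).symm
  obtain ⟨n, d, hd, ⟨e⟩⟩ :=
    IsSemisimpleRing.exists_algEquiv_pi_matrix_of_isAlgClosed ℂ (MonoidAlgebra ℂ N)
  let E : ∀ i, MonoidAlgebra ℂ N →ₐ[ℂ] Matrix (Fin (d i)) (Fin (d i)) ℂ := fun i =>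
    (Pi.evalAlgHom ℂ _ i).comp e.toAlgHom
  let ρ : ∀ i, MRep N (d i) := fun i => (E i).toMonoidHom.comp (MonoidAlgebra.of ℂ N)
  have hρ : ∀ i g, ρ i g = E i (MonoidAlgebra.of ℂ N g) := fun i g => rfl
  have hE : ∀ i a, E i a = e a i := fun i a => rfl
  have hsurj : ∀ i, Function.Surjective (E i) := fun i A => by
    refine ⟨e.symm (Pi.single i A), ?_⟩
    rw [hE, AlgEquiv.apply_symm_apply]; simp
  have hsum : ∀ a : MonoidAlgebra ℂ N, a = ∑ g, a.coeff g • MonoidAlgebra.of ℂ N g := by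
    intro a
    classical
    ext g
    simp [MonoidAlgebra.coeff_sum]
  have hirr : ∀ i, MIrr (ρ i) := by
    intro i
    refine ⟨Nat.pos_of_ne_zero (hd i).out, fun M hM => scalar_of_comm M fun A => ?_⟩
    obtain ⟨a, rfl⟩ := hsurj i A
    rw [hsum a]
    simp only [map_sum, map_smul, Finset.mul_sum, Finset.sum_mul, mul_smul_comm, smul_mul_assoc]
    exact Finset.sum_congr rfl fun g _ => by rw [← hρ, hM]
  have htr : ∀ i a, (E i a).trace = ∑ g, a.coeff g * chr (ρ i) g := by
    intro i a
    conv_lhs => rw [hsum a]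
    simp only [map_sum, map_smul, Matrix.trace_sum, Matrix.trace_smul, smul_eq_mul]
    rfl
  refine ⟨n, d, ρ, hirr, ?_, ?_, ?_⟩
  · intro i j hij
    by_contra hne
    have h1 := htr i (e.symm (Pi.single i 1))
    have h2 := htr j (e.symm (Pi.single i 1))
    simp only at hij
    rw [hij, ← h2, hE, hE, AlgEquiv.apply_symm_apply] at h1
    rw [Pi.single_eq_same, Pi.single_eq_of_ne (Ne.symm hne)] at h1
    simp at h1
    exact (hd i).out h1
  · intro k σ hσ
    by_contra! hcon
    let z : MonoidAlgebra ℂ N := ∑ g, chr σ g⁻¹ • MonoidAlgebra.of ℂ N g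
    have hz : ∀ g, z.coeff g = chr σ g⁻¹ := by
      intro g
      classical
      simp [z, MonoidAlgebra.coeff_sum, Finsupp.single_apply]
    have hcomm : ∀ h, MonoidAlgebra.of ℂ N h * z = z * MonoidAlgebra.of ℂ N h := by
      intro h
      simp only [z, Finset.mul_sum, Finset.sum_mul, mul_smul_comm, smul_mul_assoc, ← map_mul]
      refine Fintype.sum_equiv (MulAut.conj h).toEquiv _ _ fun g => ?_
      have : chr σ (h * g * h⁻¹)⁻¹ = chr σ g⁻¹ := by
        simp only [chr, mul_inv_rev, inv_inv]
        rw [← mul_assoc, map_mul, map_mul, Matrix.trace_mul_comm, ← mul_assoc, ← map_mul]; simp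
      simp only [mul_inv_rev, inv_inv, mul_assoc] at this
      simp [this, mul_assoc]
    have hz0 : ∀ i, E i z = 0 := by
      intro i
      obtain ⟨c, hc⟩ := (hirr i).2 (E i z) (fun g => by
        rw [hρ, ← map_mul, ← map_mul, hcomm])
      have h1 := htr i z
      simp only [hz] at h1
      have h2 := orth (hirr i) hσ (Ne.symm (hcon i))
      simp only [mul_comm] at h1 h2
      rw [h2, hc] at h1
      have := (hd i).out
      simp [this] at h1
      rw [hc, h1, zero_smul]
    have hzz : z = 0 := by
      apply e.injective
      ext1 i
      rw [← hE, hz0]; simp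
    have := hz 1
    rw [hzz] at this
    simp [chr_one] at this
    exact hσ.1.ne (by exact_mod_cast this)
  · have h1 := e.toLinearEquiv.finrank_eq
    rw [Module.finrank_pi_fintype] at h1
    have h2 : finrank ℂ (MonoidAlgebra ℂ N) = Nat.card N := by
      rw [(MonoidAlgebra.coeffLinearEquiv ℂ : MonoidAlgebra ℂ N ≃ₗ[ℂ] (N →₀ ℂ)).finrank_eq]
      simp
    rw [← h2, h1]
    exact Finset.sum_congr rfl fun i _ => by simp [Module.finrank_matrix, sq]

open Matrix in
theorem forms_prop {G : Type} [Group G] {d : ℕ} {ρ : MRep G d} (h : MIrr ρ)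
    (l : G →* ℂˣ) {M M' : Matrix (Fin d) (Fin d) ℂ} (hu : IsUnit M.det)
    (hM : ∀ g, M * ρ g = (l g : ℂ) • ((ρ g⁻¹)ᵀ * M))
    (hM' : ∀ g, M' * ρ g = (l g : ℂ) • ((ρ g⁻¹)ᵀ * M')) : ∃ c : ℂ, M' = c • M := by
  obtain ⟨c, hc⟩ := h.2 (M⁻¹ * M') (fun g => by
    have h1 : ρ g * M⁻¹ = (l g : ℂ) • (M⁻¹ * (ρ g⁻¹)ᵀ) := by
      have := congrArg (fun X => M⁻¹ * X * M⁻¹) (hM g)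
      simp only [mul_assoc, Matrix.mul_smul, Matrix.smul_mul, Matrix.mul_nonsing_inv _ hu,
        mul_one] at this
      rwa [← mul_assoc, Matrix.nonsing_inv_mul _ hu, one_mul] at this
    rw [mul_assoc, hM', ← mul_assoc, h1]
    simp only [mul_assoc, Matrix.mul_smul, Matrix.smul_mul])
  refine ⟨c, ?_⟩
  have := congrArg (fun X => M * X) hc
  simpa [← mul_assoc, Matrix.mul_nonsing_inv _ hu] using this

open Matrix in
theorem form_symm {G : Type} [Group G] {d : ℕ} {ρ : MRep G d} (h : MIrr ρ) (hd : Odd d)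
    (l : G →* ℂˣ) {M : Matrix (Fin d) (Fin d) ℂ} (hu : IsUnit M.det)
    (hM : ∀ g, M * ρ g = (l g : ℂ) • ((ρ g⁻¹)ᵀ * M)) : Mᵀ = M := by
  obtain ⟨c, hc⟩ := forms_prop h l (M' := Mᵀ) hu hM (fun g => by
    have := congrArg Matrix.transpose (hM g⁻¹)
    rw [Matrix.transpose_mul, Matrix.transpose_smul, Matrix.transpose_mul] at this
    rw [this, inv_inv, Matrix.transpose_transpose, smul_smul, ← Units.val_mul, ← map_mul]
    simp)
  have hM0 : M ≠ 0 := by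
    rintro rfl
    haveI : Nonempty (Fin d) := ⟨⟨0, h.1⟩⟩
    simp at hu
  have h1 := congrArg Matrix.transpose hc
  rw [Matrix.transpose_transpose, Matrix.transpose_smul, hc, smul_smul] at h1
  have hc2 : c * c = 1 := by
    have h3 : (c * c - 1) • M = 0 := by rw [sub_smul, one_smul, ← h1, sub_self]
    rcases smul_eq_zero.1 h3 with h4 | h4
    · exact sub_eq_zero.1 h4
    · exact absurd h4 hM0
  have h2 := congrArg Matrix.det hc
  rw [Matrix.det_transpose, Matrix.det_smul, Fintype.card_fin] at h2
  have hc3 : c ^ d = 1 := by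
    have := hu.ne_zero
    exact (mul_right_cancel₀ this (by rw [one_mul]; exact h2)).symm
  obtain ⟨k, rfl⟩ := hd
  have : c = 1 := by
    rw [pow_succ, pow_mul, sq, hc2, one_pow, one_mul] at hc3
    exact hc3
  rw [hc, this, one_smul]

open Matrix in
def dualRep {G : Type} [Group G] {d : ℕ} (ρ : MRep G d) : MRep G d where
  toFun g := (ρ g⁻¹)ᵀ
  map_one' := by simp
  map_mul' a b := by simp [Matrix.transpose_mul]

theorem chr_dual {G : Type} [Group G] {d : ℕ} (ρ : MRep G d) (g : G) :
    chr (dualRep ρ) g = chr ρ g⁻¹ := by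
  simp [chr, dualRep]

theorem MIrr_of_chr {G : Type} [Group G] [Finite G] {d e : ℕ} {ρ : MRep G d} {σ : MRep G e}
    (h : MIrr ρ) (hh : ∀ _s : Fintype G, ∑ g, chr σ g * chr σ g⁻¹ = ∑ g, chr ρ g * chr ρ g⁻¹) :
    MIrr σ := by
  haveI := Fintype.ofFinite G
  apply MIrr_of_norm
  rw [hh, norm_of_MIrr h]

theorem MIrr_dual {G : Type} [Group G] [Finite G] {d : ℕ} {ρ : MRep G d} (h : MIrr ρ) :
    MIrr (dualRep ρ) := by
  apply MIrr_of_chr h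
  intro s
  simp only [chr_dual, inv_inv, mul_comm]

open Matrix in
theorem exists_form {G : Type} [Group G] [Finite G] {d : ℕ} {ρ : MRep G d} (h : MIrr ρ)
    (hd : Odd d) (hr : ∀ g, chr ρ g⁻¹ = chr ρ g) :
    ∃ B : Matrix (Fin d) (Fin d) ℂ, IsUnit B.det ∧ Bᵀ = B ∧ ∀ g, B * ρ g = (ρ g⁻¹)ᵀ * B := by
  obtain ⟨B, hB, h2⟩ := exists_intertwiner h (MIrr_dual h) (by ext g; rw [chr_dual, hr])
  exact ⟨B, hB, form_symm h hd 1 hB (fun g => by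
    rw [MonoidHom.one_apply, Units.val_one, one_smul]; exact h2 g), h2⟩

def twist {G : Type} [Group G] {d : ℕ} (ρ : MRep G d) (l : G →* ℂˣ) : MRep G d where
  toFun g := (l g : ℂ) • ρ g
  map_one' := by simp
  map_mul' a b := by simp [smul_smul, mul_comm]

theorem chr_twist {G : Type} [Group G] {d : ℕ} (ρ : MRep G d) (l : G →* ℂˣ) (g : G) :
    chr (twist ρ l) g = (l g : ℂ) * chr ρ g := by
  simp [chr, twist]

theorem MIrr_twist {G : Type} [Group G] [Finite G] {d : ℕ} {ρ : MRep G d} (h : MIrr ρ)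
    (l : G →* ℂˣ) : MIrr (twist ρ l) := by
  apply MIrr_of_chr h
  intro s
  refine Finset.sum_congr rfl fun g _ => ?_
  rw [chr_twist, chr_twist, mul_mul_mul_comm, ← Units.val_mul, ← map_mul]
  simp

theorem common_eigen {ι : Type} : ∀ (n : ℕ) (V : Type) [AddCommGroup V] [Module ℂ V]
    [FiniteDimensional ℂ V] (f : ι → Module.End ℂ V), finrank ℂ V = n → 0 < n →
    (∀ i j, Commute (f i) (f j)) → ∃ v : V, v ≠ 0 ∧ ∀ i, ∃ c : ℂ, f i v = c • v := by
  intro n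
  induction n using Nat.strong_induction_on with
  | _ n ih =>
  intro V _ _ _ f hn hpos hc
  haveI : Nontrivial V := Module.nontrivial_of_finrank_pos (R := ℂ) (hn ▸ hpos)
  by_cases hall : ∀ i, ∃ c : ℂ, ∀ v, f i v = c • v
  · obtain ⟨v, hv⟩ := exists_ne (0 : V)
    exact ⟨v, hv, fun i => (hall i).imp fun c h => h v⟩
  · push Not at hall
    obtain ⟨i, hi⟩ := hall
    obtain ⟨μ, hμ⟩ := Module.End.exists_eigenvalue (f i)
    let W := Module.End.eigenspace (f i) μ
    have hinv : ∀ j, ∀ w ∈ W, f j w ∈ W := by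
      intro j w hw
      rw [Module.End.mem_eigenspace_iff] at hw ⊢
      have := congrArg (fun g : Module.End ℂ V => g w) (hc i j).eq
      simp only [Module.End.mul_apply] at this
      rw [this, hw, map_smul]
    have hlt : finrank ℂ W < n := by
      rw [← hn]
      apply Submodule.finrank_lt
      intro htop
      obtain ⟨v, hv⟩ := hi μ
      apply hv
      have : v ∈ W := by rw [htop]; trivial
      exact Module.End.mem_eigenspace_iff.1 this
    have hWpos : 0 < finrank ℂ W := by
      rw [Module.finrank_pos_iff]
      exact Submodule.nontrivial_iff_ne_bot.2 hμ
    obtain ⟨v, hv, h⟩ := ih _ hlt W (fun j => (f j).restrict (hinv j)) rfl hWpos (by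
      intro j k
      ext w
      have := congrArg (fun g : Module.End ℂ V => g w) (hc j k).eq
      simpa using this)
    refine ⟨v, by simpa using hv, fun j => ?_⟩
    obtain ⟨c, hc⟩ := h j
    exact ⟨c, by simpa using congrArg Subtype.val hc⟩

open Matrix in
theorem span_orbit {G : Type} [Group G] [Finite G] {d : ℕ} {ρ : MRep G d} (h : MIrr ρ)
    (v : Fin d → ℂ) (hv : v ≠ 0) :
    Submodule.span ℂ (Set.range fun g => ρ g *ᵥ v) = ⊤ := by
  haveI := Fintype.ofFinite G
  obtain ⟨i, hi⟩ := Function.ne_iff.1 hv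
  let w : Fin d → ℂ := Pi.single i (v i)⁻¹
  have hw : v ⬝ᵥ w = 1 := by
    simp only [w, dotProduct_single]
    exact mul_inv_cancel₀ hi
  let P : Matrix (Fin d) (Fin d) ℂ := ∑ g, ρ g * vecMulVec v w * ρ g⁻¹
  obtain ⟨c, hc⟩ := h.2 P (fun x => by
    simp only [P, Finset.mul_sum, Finset.sum_mul]
    refine Fintype.sum_equiv (Equiv.mulLeft x⁻¹) _ _ fun g => ?_
    simp only [Equiv.coe_mulLeft, _root_.mul_inv_rev, inv_inv, map_mul]
    have : ρ x * ρ x⁻¹ = 1 := by rw [← map_mul]; simp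
    simp only [← mul_assoc, this, one_mul])
  have htr : P.trace = Nat.card G := by
    simp only [P, Matrix.trace_sum]
    have : ∀ g, (ρ g * vecMulVec v w * ρ g⁻¹).trace = 1 := by
      intro g
      rw [Matrix.trace_mul_comm, ← mul_assoc, ← map_mul]
      simp [Matrix.trace_vecMulVec, hw]
    simp [this]
  have hc0 : c ≠ 0 := by
    rintro rfl
    rw [hc] at htr
    simp at htr
    exact Nat.card_pos.ne' (by rw [Nat.card_eq_fintype_card]; exact_mod_cast htr.symm : Nat.card G = 0)
  rw [eq_top_iff]
  rintro x -
  have hx : c • x = ∑ g, (w ⬝ᵥ (ρ g⁻¹ *ᵥ x)) • (ρ g *ᵥ v) := by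
    have : P *ᵥ x = c • x := by rw [hc]; simp [Matrix.smul_mulVec]
    rw [← this]
    simp only [P, Matrix.sum_mulVec, ← Matrix.mulVec_mulVec, Matrix.vecMulVec_mulVec]
    refine Finset.sum_congr rfl fun g _ => ?_
    simp [Matrix.mulVec_smul]
  have : x = c⁻¹ • ∑ g, (w ⬝ᵥ (ρ g⁻¹ *ᵥ x)) • (ρ g *ᵥ v) := by
    rw [← hx, smul_smul, inv_mul_cancel₀ hc0, one_smul]
  rw [this]
  exact Submodule.smul_mem _ _ (Submodule.sum_mem _ fun g _ =>
    Submodule.smul_mem _ _ (Submodule.subset_span ⟨g, rfl⟩))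

def Stab {G : Type} [Group G] {d : ℕ} (ρ : MRep G d) : Type :=
  {l : G →* ℂˣ // ∀ g, (l g : ℂ) * chr ρ g = chr ρ g}

open Matrix in
theorem stab_bound {G : Type} [Group G] [Finite G] {d : ℕ} {ρ : MRep G d} (h : MIrr ρ)
    (hd : Odd d) (hr : ∀ g, chr ρ g⁻¹ = chr ρ g) : Nat.card (Stab ρ) ≤ d := by
  obtain ⟨B, hBu, hBs, hB⟩ := exists_form h hd hr
  have hex : ∀ l : Stab ρ, ∃ T : Matrix (Fin d) (Fin d) ℂ, IsUnit T.det ∧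
      ∀ g, T * ρ g = (l.1 g : ℂ) • (ρ g * T) := by
    intro l
    obtain ⟨T, hT, h2⟩ := exists_intertwiner h (MIrr_twist h l.1) (by
      ext g; rw [chr_twist, l.2])
    refine ⟨T, hT, fun g => ?_⟩
    rw [h2 g]
    exact Matrix.smul_mul _ _ _
  choose φ hφu hφ using hex
  have hsym : ∀ (l : G →* ℂˣ) (T : Matrix (Fin d) (Fin d) ℂ), IsUnit T.det →
      (∀ g, T * ρ g = (l g : ℂ) • (ρ g * T)) → Tᵀ * B = B * T := by
    intro l T hT h1
    have := form_symm h hd l (M := B * T) (by rw [Matrix.det_mul]; exact hBu.mul hT) (fun g => by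
      rw [mul_assoc, h1, Matrix.mul_smul, ← mul_assoc, hB, mul_assoc])
    rwa [Matrix.transpose_mul, hBs] at this
  have hcomm : ∀ l m, φ l * φ m = φ m * φ l := by
    intro l m
    have h1 := hsym (l.1 * m.1) (φ l * φ m) (by rw [Matrix.det_mul]; exact (hφu l).mul (hφu m))
      (fun g => by
        rw [mul_assoc, hφ m, Matrix.mul_smul, ← mul_assoc, hφ l, Matrix.smul_mul, smul_smul,
          mul_assoc, mul_comm (m.1 g : ℂ)]
        simp)
    rw [Matrix.transpose_mul, mul_assoc, hsym l.1 _ (hφu l) (hφ l), ← mul_assoc,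
      hsym m.1 _ (hφu m) (hφ m), mul_assoc] at h1
    have := congrArg (fun X => B⁻¹ * X) h1
    simpa [← mul_assoc, Matrix.nonsing_inv_mul _ hBu] using this.symm
  obtain ⟨v, hv, hc⟩ := common_eigen (ι := Stab ρ) d (Fin d → ℂ) (fun l => Matrix.toLin' (φ l))
    (by simp) h.1 (fun l m => by
      change _ * _ = _ * _
      rw [Module.End.mul_eq_comp, Module.End.mul_eq_comp, ← Matrix.toLin'_mul,
        ← Matrix.toLin'_mul, hcomm])
  choose c hc using hc
  have hc0 : ∀ l, c l ≠ 0 := by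
    intro l h0
    have h1 := hc l
    rw [h0, zero_smul, Matrix.toLin'_apply] at h1
    have := congrArg (fun x => (φ l)⁻¹ *ᵥ x) h1
    simp [Matrix.nonsing_inv_mul _ (hφu l)] at this
    exact hv this
  have hφv : ∀ l g, φ l *ᵥ (ρ g *ᵥ v) = ((l.1 g : ℂ) * c l) • (ρ g *ᵥ v) := by
    intro l g
    have h1 := hc l
    rw [Matrix.toLin'_apply] at h1
    rw [Matrix.mulVec_mulVec, hφ, Matrix.smul_mulVec, ← Matrix.mulVec_mulVec, h1,
      Matrix.mulVec_smul, smul_smul]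
  obtain ⟨b, hbsub, hbspan, hbli⟩ := exists_linearIndependent ℂ (Set.range fun g => ρ g *ᵥ v)
  rw [span_orbit h v hv] at hbspan
  have hbfin : Finite b := hbli.finite
  haveI := Fintype.ofFinite b
  have hbcard : Fintype.card b ≤ d := by
    simpa using hbli.fintype_card_le_finrank
  choose γ hγ using fun x : b => hbsub x.2
  have hli : LinearIndependent ℂ (fun (l : Stab ρ) (x : b) => (l.1 (γ x) : ℂ)) := by
    rw [linearIndependent_iff']
    intro s a ha
    let M : Matrix (Fin d) (Fin d) ℂ := ∑ l ∈ s, (a l * (c l)⁻¹) • φ l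
    have hMg : ∀ g, M *ᵥ (ρ g *ᵥ v) = (∑ l ∈ s, a l * (l.1 g : ℂ)) • (ρ g *ᵥ v) := by
      intro g
      simp only [M, Matrix.sum_mulVec, Matrix.smul_mulVec, hφv, smul_smul, Finset.sum_smul]
      refine Finset.sum_congr rfl fun l _ => ?_
      congr 1
      have := hc0 l
      field_simp
    have hM0 : Matrix.toLin' M = 0 := by
      apply LinearMap.ext_on hbspan
      intro x hx
      have h1 := hMg (γ ⟨x, hx⟩)
      have h2 := congrFun ha ⟨x, hx⟩
      simp only [Finset.sum_apply, Pi.smul_apply, smul_eq_mul, Pi.zero_apply] at h2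
      have h3 := hγ ⟨x, hx⟩
      simp only at h3
      rw [h2, zero_smul, h3] at h1
      simpa using h1
    have hM1 : M = 0 := by simpa using hM0
    have hz : ∀ g, ∑ l ∈ s, a l * (l.1 g : ℂ) = 0 := by
      intro g
      have h1 := hMg g
      rw [hM1, Matrix.zero_mulVec] at h1
      rcases smul_eq_zero.1 h1.symm with h2 | h2
      · exact h2
      · exfalso
        have := congrArg (fun x => ρ g⁻¹ *ᵥ x) h2
        simp only [Matrix.mulVec_mulVec, ← map_mul] at this
        simp at this
        exact hv this
    have hded := (linearIndependent_monoidHom G ℂ).comp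
      (fun l : Stab ρ => (Units.coeHom ℂ).comp l.1) (by
        intro l m hlm
        apply Subtype.ext
        ext g
        exact DFunLike.congr_fun hlm g)
    rw [linearIndependent_iff'] at hded
    apply hded s a
    ext g
    simpa using hz g
  haveI : Finite (Stab ρ) := hli.finite
  haveI := Fintype.ofFinite (Stab ρ)
  have := hli.fintype_card_le_finrank
  rw [Nat.card_eq_fintype_card]
  rw [Module.finrank_fintype_fun_eq_card] at this
  exact this.trans hbcard

def conjRep {G : Type} [Group G] (N : Subgroup G) [N.Normal] {d : ℕ} (ρ : MRep N d) (g : G) :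
    MRep N d := ρ.comp (MulAut.conjNormal g).toMonoidHom

theorem conjRep_apply {G : Type} [Group G] (N : Subgroup G) [N.Normal] {d : ℕ} (ρ : MRep N d)
    (g : G) (n : N) : conjRep N ρ g n = ρ (MulAut.conjNormal g n) := rfl

theorem chr_conjRep {G : Type} [Group G] (N : Subgroup G) [N.Normal] {d : ℕ} (ρ : MRep N d)
    (g : G) (n : N) : chr (conjRep N ρ g) n = chr ρ (MulAut.conjNormal g n) := rfl

theorem MIrr_conjRep {G : Type} [Group G] [Finite G] (N : Subgroup G) [N.Normal] {d : ℕ}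
    {ρ : MRep N d} (h : MIrr ρ) (g : G) : MIrr (conjRep N ρ g) := by
  apply MIrr_of_chr h
  intro s
  refine Fintype.sum_equiv (MulAut.conjNormal g).toEquiv _ _ fun n => ?_
  simp [chr_conjRep]

theorem conj_intertwiner {G : Type} [Group G] [Finite G] (N : Subgroup G) [N.Normal] {d : ℕ}
    {ρ : MRep N d} (h : MIrr ρ)
    (hinv : ∀ (g : G) (n : N), chr ρ (MulAut.conjNormal g n) = chr ρ n) (g : G) :
    ∃ T : Matrix (Fin d) (Fin d) ℂ, IsUnit T.det ∧
      ∀ n : N, T * ρ n = ρ (MulAut.conjNormal g n) * T :=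
  exists_intertwiner h (MIrr_conjRep N h g) (by ext n; rw [chr_conjRep, hinv])

theorem det_conj {G : Type} [Group G] [Finite G] (N : Subgroup G) [N.Normal] {d : ℕ}
    {ρ : MRep N d} (h : MIrr ρ)
    (hinv : ∀ (g : G) (n : N), chr ρ (MulAut.conjNormal g n) = chr ρ n) (g : G) (n : N) :
    (ρ (MulAut.conjNormal g n)).det = (ρ n).det := by
  obtain ⟨T, hT, h1⟩ := conj_intertwiner N h hinv g
  have := congrArg Matrix.det (h1 n)
  rw [Matrix.det_mul, Matrix.det_mul, mul_comm] at this
  exact (mul_right_cancel₀ hT.ne_zero this).symm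

open Matrix in
theorem form_mul {G : Type} [Group G] {d : ℕ} {ρ : MRep G d} {B : Matrix (Fin d) (Fin d) ℂ}
    (hB : ∀ g, B * ρ g = (ρ g⁻¹)ᵀ * B) (g : G) : (ρ g)ᵀ * B * ρ g = B := by
  rw [mul_assoc, hB, ← mul_assoc, ← Matrix.transpose_mul, ← map_mul]
  simp

open Matrix in
theorem form_det {G : Type} [Group G] {d : ℕ} {ρ : MRep G d} {B : Matrix (Fin d) (Fin d) ℂ}
    (hu : IsUnit B.det)
    (hB : ∀ g, B * ρ g = (ρ g⁻¹)ᵀ * B) (g : G) : (ρ g).det ^ 2 = 1 := by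
  have := congrArg Matrix.det (form_mul hB g)
  rw [Matrix.det_mul, Matrix.det_mul, Matrix.det_transpose] at this
  have h0 := hu.ne_zero
  apply mul_right_cancel₀ h0
  rw [one_mul]
  linear_combination this

open Matrix in
theorem extend {G : Type} [Group G] [Finite G] (N : Subgroup G) [N.Normal] {d : ℕ}
    {ρ : MRep N d} (h : MIrr ρ) (hd : Odd d) (hr : ∀ n, chr ρ n⁻¹ = chr ρ n)
    (hinv : ∀ (g : G) (n : N), chr ρ (MulAut.conjNormal g n) = chr ρ n)
    (hdet : ∀ n, (ρ n).det = 1) :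
    ∃ R : MRep G d, MIrr R ∧ ∀ g, chr R g⁻¹ = chr R g := by
  obtain ⟨B, hBu, hBs, hB⟩ := exists_form h hd hr
  have hBm := form_mul hB
  let Good : G → Matrix (Fin d) (Fin d) ℂ → Prop := fun g T =>
    T.det = 1 ∧ Tᵀ * B * T = B ∧ ∀ n : N, T * ρ n = ρ (MulAut.conjNormal g n) * T
  have hex : ∀ g, ∃ T, Good g T := by
    intro g
    obtain ⟨T, hTu, hT⟩ := conj_intertwiner N h hinv g
    have hTB : ∀ n : N, (Tᵀ * B * T) * ρ n = ((1 : N →* ℂˣ) n : ℂ) • ((ρ n⁻¹)ᵀ * (Tᵀ * B * T)) := by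
      intro n
      have h1 : (ρ n⁻¹)ᵀ * Tᵀ = Tᵀ * (ρ (MulAut.conjNormal g n)⁻¹)ᵀ := by
        rw [← Matrix.transpose_mul, ← Matrix.transpose_mul, hT, map_inv]
      simp only [MonoidHom.one_apply, Units.val_one, one_smul]
      rw [mul_assoc, hT, mul_assoc, ← mul_assoc B, hB, ← mul_assoc, ← mul_assoc,
        ← mul_assoc, ← mul_assoc, h1]
    obtain ⟨c, hc⟩ := forms_prop h 1 (M' := Tᵀ * B * T) hBu (fun n => by simpa using hB n) hTB
    have hc0 : c ≠ 0 := by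
      rintro rfl
      have hdd := congrArg Matrix.det hc
      have hne : Nonempty (Fin d) := ⟨⟨0, h.1⟩⟩
      rw [Matrix.det_mul, Matrix.det_mul, Matrix.det_transpose, zero_smul,
        Matrix.det_zero] at hdd
      simp [hTu.ne_zero, hBu.ne_zero] at hdd
    obtain ⟨s, hs⟩ := IsAlgClosed.exists_pow_nat_eq c (n := 2) (by norm_num)
    have hs0 : s ≠ 0 := by rintro rfl; exact hc0 (by rw [← hs]; simp)
    let T1 := s⁻¹ • T
    have h1 : T1ᵀ * B * T1 = B := by
      simp only [T1, Matrix.transpose_smul, Matrix.smul_mul, Matrix.mul_smul, hc, smul_smul]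
      rw [← hs]
      have : s⁻¹ * (s⁻¹ * s ^ 2) = 1 := by field_simp
      rw [this, one_smul]
    have h2 : ∀ n : N, T1 * ρ n = ρ (MulAut.conjNormal g n) * T1 := by
      intro n
      simp only [T1, Matrix.smul_mul, Matrix.mul_smul, hT]
    have h3 : T1.det ^ 2 = 1 := by
      have := congrArg Matrix.det h1
      rw [Matrix.det_mul, Matrix.det_mul, Matrix.det_transpose] at this
      have h0 := hBu.ne_zero
      apply mul_right_cancel₀ h0
      rw [one_mul]
      linear_combination this
    have h5 : (T1.det - 1) * (T1.det + 1) = 0 := by linear_combination h3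
    have h6 : T1.det = 1 ∨ T1.det = -1 :=
      (mul_eq_zero.1 h5).imp sub_eq_zero.1 eq_neg_of_add_eq_zero_left
    rcases h6 with h4 | h4
    · exact ⟨T1, h4, h1, h2⟩
    · refine ⟨-T1, ?_, ?_, ?_⟩
      · rw [Matrix.det_neg, h4, Fintype.card_fin, hd.neg_one_pow]; norm_num
      · simpa using h1
      · intro n; simp [h2]
  have huniq : ∀ g T T', Good g T → Good g T' → T = T' := by
    rintro g T T' ⟨a1, a2, a3⟩ ⟨b1, b2, b3⟩
    have hu : IsUnit T.det := by rw [a1]; exact isUnit_one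
    obtain ⟨c, hc⟩ := h.2 (T⁻¹ * T') (fun n => by
      have h1 : T⁻¹ * ρ (MulAut.conjNormal g n) = ρ n * T⁻¹ := by
        have := congrArg (fun X => T⁻¹ * X * T⁻¹) (a3 n)
        simp only [mul_assoc, Matrix.mul_nonsing_inv _ hu, mul_one] at this
        rw [← mul_assoc T⁻¹ T, Matrix.nonsing_inv_mul _ hu, one_mul] at this
        exact this.symm
      rw [mul_assoc, b3, ← mul_assoc, h1, mul_assoc])
    have hT' : T' = c • T := by
      have := congrArg (fun X => T * X) hc
      simpa [← mul_assoc, Matrix.mul_nonsing_inv _ hu] using this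
    rw [hT', Matrix.det_smul, a1, mul_one, Fintype.card_fin] at b1
    rw [hT'] at b2
    simp only [Matrix.transpose_smul, Matrix.smul_mul, Matrix.mul_smul, smul_smul, a2] at b2
    have hc2 : c * c = 1 := by
      have := congrArg (fun X => (X * B⁻¹) ⟨0, h.1⟩ ⟨0, h.1⟩) b2
      simpa [Matrix.smul_mul, Matrix.mul_nonsing_inv _ hBu] using this
    obtain ⟨k, rfl⟩ := hd
    rw [pow_succ, pow_mul, sq, hc2, one_pow, one_mul] at b1
    rw [hT', b1, one_smul]
  choose R hR using hex
  have hRmul : ∀ a b, R (a * b) = R a * R b := by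
    intro a b
    apply huniq (a * b) _ _ (hR _)
    obtain ⟨a1, a2, a3⟩ := hR a
    obtain ⟨b1, b2, b3⟩ := hR b
    refine ⟨by rw [Matrix.det_mul, a1, b1, one_mul], ?_, fun n => ?_⟩
    · rw [Matrix.transpose_mul]
      calc _ = (R b)ᵀ * ((R a)ᵀ * B * R a) * R b := by simp only [mul_assoc]
        _ = _ := by rw [a2, b2]
    · rw [mul_assoc, b3, ← mul_assoc, a3, mul_assoc, map_mul]; rfl
  have hRn : ∀ n : N, R n = ρ n := by
    intro n
    apply huniq n _ _ (hR _)
    refine ⟨hdet n, hBm n, fun m => ?_⟩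
    rw [← map_mul, ← map_mul]
    congr 1
    ext
    simp
  have hR1 : R 1 = 1 := by
    have := hRn 1
    simpa using this
  let RR : MRep G d := ⟨⟨R, hR1⟩, hRmul⟩
  have hRR : ∀ g, RR g = R g := fun g => rfl
  refine ⟨RR, ⟨h.1, fun M hM => h.2 M fun n => ?_⟩, fun g => ?_⟩
  · rw [← hRn, ← hRR, hM]
  · have h1 := (hR g).2.1
    have h2 : R g * R g⁻¹ = 1 := by rw [← hRmul, mul_inv_cancel, hR1]
    have h3 : (R g)ᵀ * B = B * R g⁻¹ := by
      have := congrArg (fun X => X * R g⁻¹) h1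
      simpa [mul_assoc, h2] using this
    have h4 : R g⁻¹ = B⁻¹ * ((R g)ᵀ * B) := by
      rw [h3, ← mul_assoc, Matrix.nonsing_inv_mul _ hBu, one_mul]
    change (R g⁻¹).trace = (R g).trace
    rw [h4, ← mul_assoc, Matrix.trace_mul_comm, ← mul_assoc, Matrix.mul_nonsing_inv _ hBu,
      one_mul, Matrix.trace_transpose]

theorem mem_irr {G : Type} [Group G] [Finite G] {χ : G → ℂ} :
    χ ∈ IrrP' 2 G ↔ ∃ d, ∃ ρ : MRep G d, MIrr ρ ∧ Odd d ∧ χ = chr ρ := by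
  unfold IrrP'
  simp only [Set.mem_ofPred_eq, irrchar_iff, ← even_iff_two_dvd, Nat.not_even_iff_odd]
  constructor
  · rintro ⟨d, ⟨ρ, h1, h2⟩, h3⟩
    exact ⟨d, ρ, h1, h3, h2⟩
  · rintro ⟨d, ρ, h1, h3, h2⟩
    exact ⟨d, ⟨ρ, h1, h2⟩, h3⟩

theorem irr_image {G : Type} [Group G] [Finite G] :
    (IrrP' 2 G).Finite ∧ (Even (Nat.card G) → Even (IrrP' 2 G).ncard) := by
  classical
  obtain ⟨n, d, ρ, hirr, hinj, hall, hsum⟩ := wed G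
  have hS : IrrP' 2 G = (fun i => chr (ρ i)) ''
      ((Finset.univ.filter fun i => Odd (d i ^ 2) : Finset (Fin n)) : Set (Fin n)) := by
    ext χ
    rw [mem_irr]
    constructor
    · rintro ⟨e, σ, h1, h2, rfl⟩
      obtain ⟨i, hi⟩ := hall e σ h1
      refine ⟨i, ?_, hi.symm⟩
      have h3 := congrFun hi 1
      rw [chr_one, chr_one] at h3
      have h4 : e = d i := by exact_mod_cast h3
      simp only [Finset.coe_filter, Finset.mem_univ, true_and, Set.mem_ofPred_eq]
      rw [← h4]
      exact h2.pow
    · rintro ⟨i, hi, rfl⟩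
      refine ⟨d i, ρ i, hirr i, ?_, rfl⟩
      simp only [Finset.coe_filter, Finset.mem_univ, true_and, Set.mem_ofPred_eq] at hi
      exact (Nat.odd_pow_iff (by norm_num)).1 hi
  rw [hS]
  refine ⟨(Finset.finite_toSet _).image _, fun hE => ?_⟩
  rw [Set.ncard_image_of_injective _ hinj, Set.ncard_coe_finset]
  rw [← hsum] at hE
  exact (Finset.even_sum_iff_even_card_odd _).1 hE

def trivRep (G : Type) [Group G] : MRep G 1 := 1

theorem MIrr_triv (G : Type) [Group G] : MIrr (trivRep G) :=
  ⟨one_pos, fun M _ => ⟨M 0 0, by ext i j; fin_cases i; fin_cases j; simp⟩⟩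

theorem chr_triv (G : Type) [Group G] (g : G) : chr (trivRep G) g = 1 := by
  simp [chr, trivRep]

theorem chr_class {G : Type} [Group G] {d : ℕ} (ρ : MRep G d) (a b : G) :
    chr ρ (a * b * a⁻¹) = chr ρ b := by
  simp only [chr, map_mul]
  rw [Matrix.trace_mul_comm, ← mul_assoc, ← map_mul]
  simp

def RealIrr (N : Type) [Group N] : Set (N → ℂ) := {χ | χ ∈ IrrP' 2 N ∧ ∀ n, χ n⁻¹ = χ n}

theorem real_even {N : Type} [Group N] [Finite N] (hE : Even (Nat.card N)) :
    2 ∣ Nat.card (RealIrr N) := by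
  classical
  obtain ⟨hf, he⟩ := irr_image (G := N)
  haveI := hf.fintype
  let f : Function.End (IrrP' 2 N) := fun χ => ⟨fun n => χ.1 n⁻¹, by
    obtain ⟨d, ρ, h1, h2, h3⟩ := mem_irr.1 χ.2
    refine mem_irr.2 ⟨d, dualRep ρ, MIrr_dual h1, h2, ?_⟩
    ext n
    rw [chr_dual, h3]⟩
  have hff : f ^ 2 ^ 1 = 1 := by
    rw [pow_one, sq]
    funext χ
    apply Subtype.ext
    funext n
    change χ.1 n⁻¹⁻¹ = χ.1 n
    rw [inv_inv]
  have h1 := Equiv.Perm.card_fixedPoints_modEq hff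
  have h2 : Fintype.card (Function.fixedPoints f) = Nat.card (RealIrr N) := by
    rw [← Nat.card_eq_fintype_card]
    refine Nat.card_congr ⟨fun χ => ⟨χ.1.1, χ.1.2, fun n => ?_⟩,
      fun χ => ⟨⟨χ.1, χ.2.1⟩, ?_⟩, fun χ => rfl, fun χ => rfl⟩
    · have := congrArg Subtype.val χ.2
      exact congrFun this n
    · apply Subtype.ext
      funext n
      exact χ.2.2 n
  rw [← h2]
  have h3 : 2 ∣ Fintype.card (IrrP' 2 N) := by
    rw [← Nat.card_eq_fintype_card, Nat.card_coe_set_eq, ← even_iff_two_dvd]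
    exact he hE
  exact (Nat.modEq_zero_iff_dvd.1 (h1.symm.trans (Nat.modEq_zero_iff_dvd.2 h3)))

instance realAct {G : Type} [Group G] [Finite G] (N : Subgroup G) [N.Normal] :
    MulAction G (RealIrr N) where
  smul g χ := ⟨fun n => χ.1 (MulAut.conjNormal g⁻¹ n), by
    obtain ⟨hχ, hr⟩ := χ.2
    obtain ⟨d, ρ, h1, h2, h3⟩ := mem_irr.1 hχ
    refine ⟨mem_irr.2 ⟨d, conjRep N ρ g⁻¹, MIrr_conjRep N h1 g⁻¹, h2, ?_⟩, fun n => ?_⟩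
    · ext n
      rw [chr_conjRep, h3]
    · change χ.1 (MulAut.conjNormal g⁻¹ n⁻¹) = χ.1 (MulAut.conjNormal g⁻¹ n)
      rw [map_inv (MulAut.conjNormal g⁻¹) n, hr]⟩
  one_smul χ := by
    apply Subtype.ext
    funext n
    change χ.1 (MulAut.conjNormal (1 : G)⁻¹ n) = χ.1 n
    simp
  mul_smul a b χ := by
    apply Subtype.ext
    funext n
    change χ.1 (MulAut.conjNormal (a * b)⁻¹ n) =
      χ.1 (MulAut.conjNormal b⁻¹ (MulAut.conjNormal a⁻¹ n))
    rw [mul_inv_rev, map_mul]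
    rfl

theorem realAct_val {G : Type} [Group G] [Finite G] (N : Subgroup G) [N.Normal] (g : G)
    (χ : RealIrr N) (n : N) : (g • χ).1 n = χ.1 (MulAut.conjNormal g⁻¹ n) := rfl

theorem pow_mem_of_pgroup {G : Type} [Group G] {N : Subgroup G} [N.Normal]
    (hp : IsPGroup 2 (G ⧸ N)) (g : G) : ∃ k : ℕ, g ^ 2 ^ k ∈ N := by
  obtain ⟨k, hk⟩ := hp (g : G ⧸ N)
  refine ⟨k, ?_⟩
  rw [← QuotientGroup.mk_pow] at hk
  exact (QuotientGroup.eq_one_iff _).1 hk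

theorem step1 {G : Type} [Group G] [Finite G] (N : Subgroup G) [N.Normal]
    (hp : IsPGroup 2 (G ⧸ N)) (hE : Even (Nat.card N)) :
    ∃ d, ∃ ρ : MRep N d, MIrr ρ ∧ Odd d ∧ (∀ n, chr ρ n⁻¹ = chr ρ n) ∧
      (∀ (g : G) (n : N), chr ρ (MulAut.conjNormal g n) = chr ρ n) ∧ ∃ n, chr ρ n ≠ 1 := by
  haveI hfin : Finite (RealIrr N) :=
    ((irr_image (G := N)).1.subset fun χ h => h.1).to_subtype
  let φ := MulAction.toPermHom G (RealIrr N)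
  have hP : IsPGroup 2 φ.range := by
    rintro ⟨_, g, rfl⟩
    obtain ⟨k, hk⟩ := pow_mem_of_pgroup hp g
    refine ⟨k, ?_⟩
    apply Subtype.ext
    change (φ g) ^ 2 ^ k = 1
    rw [← map_pow]
    ext χ n
    change (g ^ 2 ^ k • χ).1 n = χ.1 n
    rw [realAct_val]
    obtain ⟨d, ρ, h1, h2, h3⟩ := mem_irr.1 χ.2.1
    rw [h3]
    have : MulAut.conjNormal (g ^ 2 ^ k)⁻¹ n =
        (⟨g ^ 2 ^ k, hk⟩ : N)⁻¹ * n * (⟨g ^ 2 ^ k, hk⟩ : N)⁻¹⁻¹ := by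
      ext
      rw [MulAut.conjNormal_apply]
      simp
    rw [this, chr_class]
  let t : RealIrr N := ⟨fun _ => 1, mem_irr.2 ⟨1, trivRep N, MIrr_triv _, odd_one, by
    ext n; rw [chr_triv]⟩, fun n => rfl⟩
  have ht : t ∈ MulAction.fixedPoints φ.range (RealIrr N) := by
    rintro ⟨_, g, rfl⟩
    rfl
  haveI : Fact (Nat.Prime 2) := ⟨Nat.prime_two⟩
  obtain ⟨χ, hχ, hne⟩ := hP.exists_fixed_point_of_prime_dvd_card_of_fixed_point (RealIrr N)
    (real_even hE) ht
  obtain ⟨d, ρ, h1, h2, h3⟩ := mem_irr.1 χ.2.1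
  refine ⟨d, ρ, h1, h2, ?_, ?_, ?_⟩
  · rw [← h3]; exact χ.2.2
  · intro g n
    have h4 := hχ ⟨φ g⁻¹, g⁻¹, rfl⟩
    have h5 : (g⁻¹ • χ).1 n = χ.1 n := congrFun (congrArg Subtype.val h4) n
    rw [realAct_val, inv_inv, h3] at h5
    exact h5
  · by_contra hcon
    push Not at hcon
    apply hne
    apply Subtype.ext
    rw [h3]
    funext n
    exact (hcon n).symm

theorem step2 {G : Type} [Group G] [Finite G] (N : Subgroup G) [N.Normal]
    (hp : IsPGroup 2 (G ⧸ N))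
    (hmin : ∀ (K : Subgroup G) (_ : K.Normal), IsPGroup 2 (G ⧸ K) → Nat.card N ≤ Nat.card K)
    {d : ℕ} {ρ : MRep N d} (h : MIrr ρ) (hd : Odd d) (hr : ∀ n, chr ρ n⁻¹ = chr ρ n)
    (hinv : ∀ (g : G) (n : N), chr ρ (MulAut.conjNormal g n) = chr ρ n) (n : N) :
    (ρ n).det = 1 := by
  obtain ⟨B, hBu, hBs, hB⟩ := exists_form h hd hr
  have hdet := form_det hBu hB
  let D : N →* ℂ := Matrix.detMonoidHom.comp ρ
  have hD : ∀ n, D n = (ρ n).det := fun n => rfl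
  let K : Subgroup G := D.ker.map N.subtype
  have hmem : ∀ x : G, x ∈ K ↔ ∃ hx : x ∈ N, (ρ ⟨x, hx⟩).det = 1 := by
    intro x
    constructor
    · rintro ⟨y, hy, rfl⟩
      exact ⟨y.2, hy⟩
    · rintro ⟨hx, h1⟩
      exact ⟨⟨x, hx⟩, h1, rfl⟩
  have hK : K.Normal := by
    refine ⟨fun x hx g => ?_⟩
    obtain ⟨hx, h1⟩ := (hmem x).1 hx
    refine (hmem _).2 ⟨Subgroup.Normal.conj_mem inferInstance x hx g, ?_⟩
    have h2 := det_conj N h hinv g ⟨x, hx⟩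
    rw [h1] at h2
    exact h2
  have hpK : IsPGroup 2 (G ⧸ K) := by
    intro q
    obtain ⟨g, rfl⟩ := QuotientGroup.mk_surjective q
    obtain ⟨k, hk⟩ := pow_mem_of_pgroup hp g
    refine ⟨k + 1, ?_⟩
    rw [← QuotientGroup.mk_pow, QuotientGroup.eq_one_iff, pow_succ, pow_mul, hmem]
    refine ⟨N.pow_mem hk 2, ?_⟩
    rw [← hdet ⟨g ^ 2 ^ k, hk⟩, ← Matrix.det_pow, ← map_pow]
    rfl
  have hKN : K ≤ N := fun x hx => ((hmem x).1 hx).1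
  have hEq : K = N := Subgroup.eq_of_le_of_card_ge hKN (hmin K hK hpK)
  have : (n : G) ∈ K := by rw [hEq]; exact n.2
  exact ((hmem _).1 this).2

theorem count {G : Type} [Group G] [Finite G] {d : ℕ} {R : MRep G d} (h : MIrr R) (hd : Odd d)
    (hd3 : 3 ≤ d) (hr : ∀ g, chr R g⁻¹ = chr R g) : 3 / 2 ≤ acdP' 2 G := by
  classical
  have hf := (irr_image (G := G)).1
  have hmemT : ∀ (l : G →* ℂˣ) {e : ℕ} {ρ : MRep G e}, MIrr ρ → Odd e →
      chr (twist ρ l) ∈ IrrP' 2 G := fun l e ρ h1 h2 =>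
    mem_irr.2 ⟨e, twist ρ l, MIrr_twist h1 l, h2, rfl⟩
  haveI hΛ : Finite (G →* ℂˣ) := by
    haveI := hf.to_subtype
    refine Finite.of_injective (β := IrrP' 2 G)
      (fun l => ⟨chr (twist (trivRep G) l), hmemT l (MIrr_triv G) odd_one⟩) ?_
    intro l m hlm
    ext g
    have := congrFun (congrArg Subtype.val hlm) g
    simpa [chr_twist, chr_triv] using this
  haveI := Fintype.ofFinite (G →* ℂˣ)
  let S := hf.toFinset
  have hS : ∀ χ, χ ∈ S ↔ χ ∈ IrrP' 2 G := fun χ => hf.mem_toFinset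
  let f : (G →* ℂˣ) → G → ℂ := fun l => chr (twist R l)
  let t : (G →* ℂˣ) → G → ℂ := fun l => chr (twist (trivRep G) l)
  let O := Finset.univ.image f
  let L := Finset.univ.image t
  have hLc : L.card ≤ Fintype.card (G →* ℂˣ) := Finset.card_image_le
  have hOc : Fintype.card (G →* ℂˣ) ≤ d * O.card := by
    refine Finset.card_le_mul_card_image Finset.univ d fun χ hχ => ?_
    obtain ⟨l0, -, rfl⟩ := Finset.mem_image.1 hχ
    refine le_trans ?_ (stab_bound h hd hr)
    haveI : Finite (Stab R) := Finite.of_injective (β := G →* ℂˣ) (fun x => x.1)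
      Subtype.val_injective
    rw [← Nat.card_eq_finsetCard]
    refine Nat.card_le_card_of_injective (fun l => (⟨l0⁻¹ * l.1, fun g => ?_⟩ : Stab R)) ?_
    · have h1 := congrFun (Finset.mem_filter.1 l.2).2 g
      simp only [f, chr_twist] at h1
      rw [MonoidHom.mul_apply, MonoidHom.inv_apply, Units.val_mul, mul_assoc, h1, ← mul_assoc]
      simp
    · intro l m hlm
      have h1 : l0⁻¹ * l.1 = l0⁻¹ * m.1 := congrArg Subtype.val hlm
      exact Subtype.ext (mul_left_cancel h1)
  have hLS : L ⊆ S := by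
    intro χ hχ
    obtain ⟨l, -, rfl⟩ := Finset.mem_image.1 hχ
    exact (hS _).2 (hmemT l (MIrr_triv G) odd_one)
  have hL1 : ∀ χ ∈ L, (χ 1).re = 1 := by
    intro χ hχ
    obtain ⟨l, -, rfl⟩ := Finset.mem_image.1 hχ
    simp [t, chr_one]
  have hO1 : ∀ χ ∈ O, (χ 1).re = d := by
    intro χ hχ
    obtain ⟨l, -, rfl⟩ := Finset.mem_image.1 hχ
    simp [f, chr_one]
  have hOS : O ⊆ S \ L := by
    intro χ hχ
    refine Finset.mem_sdiff.2 ⟨?_, fun hL => ?_⟩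
    · obtain ⟨l, -, rfl⟩ := Finset.mem_image.1 hχ
      exact (hS _).2 (hmemT l h hd)
    · have h1 := hL1 χ hL
      rw [hO1 χ hχ] at h1
      have h2 : d = 1 := by exact_mod_cast h1
      omega
  have hSL : ∀ χ ∈ S \ L, 3 ≤ (χ 1).re := by
    intro χ hχ
    obtain ⟨h1, h2⟩ := Finset.mem_sdiff.1 hχ
    obtain ⟨e, ρ, h3, h4, rfl⟩ := mem_irr.1 ((hS _).1 h1)
    rw [chr_one]
    have he : e ≠ 1 := by
      rintro rfl
      apply h2
      refine Finset.mem_image.2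
        ⟨MonoidHom.toHomUnits ((Matrix.detMonoidHom (n := Fin 1) (R := ℂ)).comp ρ),
          Finset.mem_univ _, ?_⟩
      funext g
      change chr (twist (trivRep G) _) g = _
      rw [chr_twist, chr_triv, mul_one]
      change (ρ g).det = (ρ g).trace
      simp [Matrix.trace]
    have he3 : 3 ≤ e := by
      obtain ⟨k, rfl⟩ := h4
      omega
    simpa using (by exact_mod_cast he3 : (3 : ℝ) ≤ e)
  have hdR : (3 : ℝ) ≤ d := by exact_mod_cast hd3
  have hsumO : ((d : ℝ) - 3 / 2) * O.card ≤ ∑ χ ∈ S \ L, ((χ 1).re - 3 / 2) := by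
    calc ((d : ℝ) - 3 / 2) * O.card = ∑ χ ∈ O, ((χ 1).re - 3 / 2) := by
          rw [Finset.sum_congr rfl fun χ hχ => by rw [hO1 χ hχ], Finset.sum_const, nsmul_eq_mul,
            mul_comm]
      _ ≤ _ := Finset.sum_le_sum_of_subset_of_nonneg hOS fun χ hχ _ => by
          linarith [hSL χ hχ]
  have hsumL : ∑ χ ∈ L, ((χ 1).re - 3 / 2) = -(1 / 2) * L.card := by
    rw [Finset.sum_congr rfl fun χ hχ => by rw [hL1 χ hχ], Finset.sum_const, nsmul_eq_mul]
    ring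
  have hcard : (L.card : ℝ) ≤ d * O.card := by exact_mod_cast hLc.trans hOc
  have htot : 0 ≤ ∑ χ ∈ S, ((χ 1).re - 3 / 2) := by
    rw [← Finset.sum_sdiff hLS, hsumL]
    have h0 : (0 : ℝ) ≤ O.card := Nat.cast_nonneg _
    nlinarith
  rw [Finset.sum_sub_distrib, Finset.sum_const, nsmul_eq_mul] at htot
  have hpos : 0 < S.card := Finset.card_pos.2
    ⟨_, hLS (Finset.mem_image.2 ⟨1, Finset.mem_univ _, rfl⟩)⟩
  unfold acdP'
  rw [finsum_mem_eq_finite_toFinset_sum _ hf, Set.ncard_eq_toFinset_card _ hf,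
    le_div_iff₀ (by exact_mod_cast hpos)]
  linarith

/-- Theorem 1.1(i): if `acd_{2'}(G) < 3/2` then `G` has a normal `2`-complement. -/
theorem acd_two_prime_lt_three_halves_normal_two_complement
    (G : Type) [Group G] [Finite G] (h : acdP' 2 G < 3 / 2) :
    ∃ N : Subgroup G, ∃ _ : N.Normal, ¬ 2 ∣ Nat.card N ∧ IsPGroup 2 (G ⧸ N) := by
  classical
  let P : ℕ → Prop := fun m => ∃ N : Subgroup G, ∃ _ : N.Normal, IsPGroup 2 (G ⧸ N) ∧ Nat.card N = m
  have hP : ∃ m, P m := by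
    refine ⟨Nat.card (⊤ : Subgroup G), ⊤, inferInstance, ?_, rfl⟩
    intro q
    obtain ⟨g, rfl⟩ := QuotientGroup.mk_surjective q
    exact ⟨0, by rw [pow_zero, pow_one]; exact (QuotientGroup.eq_one_iff _).2 trivial⟩
  obtain ⟨N, hN, hp, hc⟩ := Nat.find_spec hP
  refine ⟨N, hN, ?_, hp⟩
  intro hE
  have hmin : ∀ (K : Subgroup G) (_ : K.Normal), IsPGroup 2 (G ⧸ K) →
      Nat.card N ≤ Nat.card K := by
    intro K hK hpK
    rw [hc]
    exact Nat.find_min' hP ⟨K, hK, hpK, rfl⟩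
  obtain ⟨d, ρ, hirr, hd, hr, hinv, n, hn⟩ := step1 N hp (even_iff_two_dvd.2 hE)
  have hdet := step2 N hp hmin hirr hd hr hinv
  have hd1 : d ≠ 1 := by
    rintro rfl
    apply hn
    rw [← hdet n]
    simp [chr, Matrix.trace]
  obtain ⟨R, hR, hRr⟩ := extend N hirr hd hr hinv hdet
  have hd3 : 3 ≤ d := by
    obtain ⟨k, rfl⟩ := hd
    omega
  exact absurd h (not_lt.2 (count hR hd hd3 hRr))
end
end

section
/- Let p be an odd prime and G a finite group. If acd_{p'}(G) < 4/3, then G has a normal p-complement. -/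
open Module CategoryTheory

noncomputable section

theorem aux_lift_hom {G E : Type} [Group G] [Finite G] [Group E] [Finite E] (P : Subgroup G)
    (hcop : Nat.Coprime P.index (Nat.card E)) (m : P →* E) (σ : G → E)
    (hσ : ∀ g l, (σ (g * l))⁻¹ * σ g * σ l ∈ Subgroup.center E)
    (hm : ∀ x : P, (σ x)⁻¹ * m x ∈ Subgroup.center E) :
    ∃ τ : G →* E, ∀ g, (σ g)⁻¹ * τ g ∈ Subgroup.center E := by
  classical
  have hu : ∀ g : G, ((QuotientGroup.mk g : G ⧸ P).out)⁻¹ * g ∈ P := fun g => by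
    rw [← QuotientGroup.eq]; simp
  let _ : CommGroup (Subgroup.center E) :=
    { (inferInstance : Group (Subgroup.center E)) with
      mul_comm := fun a b => Subtype.ext (Subgroup.mem_center_iff.mp b.2 a) }
  let s : G → E := fun g => σ ((QuotientGroup.mk g : G ⧸ P).out) * m ⟨_, hu g⟩
  have hs : ∀ g, (σ g)⁻¹ * s g ∈ Subgroup.center E := by
    intro g
    have h1 := hσ ((QuotientGroup.mk g : G ⧸ P).out) (((QuotientGroup.mk g : G ⧸ P).out)⁻¹ * g)
    have h2 := hm ⟨_, hu g⟩
    rw [mul_inv_cancel_left] at h1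
    have h3 := mul_mem h1 h2
    simpa [s, mul_assoc] using h3
  have hsx : ∀ g (x : P), s (g * x) = s g * m x := by
    intro g x
    have : (QuotientGroup.mk (g * x) : G ⧸ P) = QuotientGroup.mk g := by
      rw [QuotientGroup.eq]; simp
    simp only [s, this, mul_assoc]
    rw [← map_mul]
    congr 2
    ext
    simp [mul_assoc]
  clear_value s
  have hc : ∀ g l, (s (g * l))⁻¹ * s g * s l ∈ Subgroup.center E := by
    intro g l
    have e : ∀ g, ∃ z ∈ Subgroup.center E, s g = σ g * z := fun g => ⟨_, hs g, by group⟩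
    obtain ⟨z1, hz1, e1⟩ := e (g * l)
    obtain ⟨z2, hz2, e2⟩ := e g
    obtain ⟨z3, hz3, e3⟩ := e l
    have := mul_mem (mul_mem (mul_mem (inv_mem hz1) (hσ g l)) hz2) hz3
    convert this using 1
    rw [e1, e2, e3]
    have h2 := Subgroup.mem_center_iff.mp hz2 (σ l)
    simp only [mul_inv_rev, mul_assoc]
    rw [← mul_assoc (σ l) z2, h2, mul_assoc]
  let c : G → G → Subgroup.center E := fun g l => ⟨_, hc g l⟩
  have hcs : ∀ g l, s g * s l = s (g * l) * c g l := fun g l => by simp [c, mul_assoc]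
  clear_value c
  have hcom : ∀ (z : Subgroup.center E) (e : E), e * z = z * e := fun z e =>
    Subgroup.mem_center_iff.mp z.2 e
  have hcx : ∀ g l (x : P), c g (l * x) = c g l := by
    intro g l x
    ext
    have h1 := hcs g (l * x)
    rw [← mul_assoc g, hsx, hsx, ← mul_assoc, hcs, mul_assoc, mul_assoc, ← hcom] at h1
    exact (mul_left_cancel (mul_left_cancel h1)).symm
  have hcoc : ∀ g l k, c g l * c (g * l) k = c l k * c g (l * k) := by
    intro g l k
    ext
    have h1 : s g * s l * s k = s (g * l * k) * (c g l * c (g * l) k : Subgroup.center E) := by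
      rw [hcs g l, mul_assoc, ← hcom, ← mul_assoc, hcs (g * l) k, mul_assoc, mul_comm (c g l)]
      rfl
    have h2 : s g * (s l * s k) = s (g * (l * k)) * (c l k * c g (l * k) : Subgroup.center E) := by
      rw [hcs l k, ← mul_assoc, hcs g (l * k), mul_assoc, mul_comm (c l k)]
      rfl
    rw [mul_assoc, h2, mul_assoc] at h1
    exact (mul_left_cancel h1).symm
  have : Fintype (G ⧸ P) := Fintype.ofFinite _
  let H : G → Subgroup.center E := fun g => ∏ q : G ⧸ P, c g q.out
  have hcq : ∀ g l, c g (QuotientGroup.mk l : G ⧸ P).out = c g l := by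
    intro g l
    have := hcx g (QuotientGroup.mk l : G ⧸ P).out ⟨_, hu l⟩
    simpa using this.symm
  have hH : ∀ g l, c g l ^ P.index * H (g * l) = H l * H g := by
    intro g l
    have h1 : H g = ∏ q : G ⧸ P, c g (l * q.out) := by
      change ∏ q : G ⧸ P, c g q.out = _
      rw [← Equiv.prod_comp (MulAction.toPerm l : Equiv.Perm (G ⧸ P)) (fun q => c g q.out)]
      refine Finset.prod_congr rfl fun q _ => ?_
      rw [← hcq g (l * q.out)]
      congr 2
      conv_lhs => rw [← QuotientGroup.out_eq' q]
      rfl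
    rw [h1, ← Finset.prod_mul_distrib, Subgroup.index_eq_card, Nat.card_eq_fintype_card,
      ← Finset.card_univ, ← Finset.prod_const, ← Finset.prod_mul_distrib]
    exact Finset.prod_congr rfl fun q _ => hcoc g l q.out
  have hcop' : (1 : ℤ) = P.index * Nat.gcdA P.index (Nat.card E)
      + (Nat.card E) * Nat.gcdB P.index (Nat.card E) := by
    rw [← Nat.gcd_eq_gcd_ab, hcop]; rfl
  set a : ℤ := Nat.gcdA P.index (Nat.card E)
  have hpow : ∀ z : Subgroup.center E, (z ^ P.index) ^ a = z := by
    intro z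
    have h1 : z ^ (Nat.card E) = 1 := by ext; simp
    have h2 : z ^ (1 : ℤ) = z := zpow_one z
    rw [hcop', zpow_add, zpow_mul, zpow_mul, zpow_natCast, zpow_natCast, h1, one_zpow, mul_one] at h2
    exact h2
  have key : ∀ g l, c g l * H (g * l) ^ a = H g ^ a * H l ^ a := by
    intro g l
    rw [← mul_zpow, mul_comm (H g), ← hH, mul_zpow, hpow]
  refine ⟨MonoidHom.mk' (fun g => s g * ((H g ^ a)⁻¹ : Subgroup.center E)) ?_, ?_⟩
  · intro g l
    have h1 : s g * ↑((H g ^ a)⁻¹) * (s l * ↑((H l ^ a)⁻¹)) =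
        s g * s l * ((H g ^ a)⁻¹ * (H l ^ a)⁻¹ : Subgroup.center E) := by
      rw [mul_assoc, ← mul_assoc _ (s l), ← hcom, Subgroup.coe_mul]
      simp only [mul_assoc]
    rw [h1, hcs, mul_assoc, ← Subgroup.coe_mul]
    congr 2
    have := key g l
    rw [← mul_inv, ← this, mul_inv, mul_inv_cancel_left]
  · intro g
    have := mul_mem (hs g) ((H g ^ a)⁻¹).2
    simpa [mul_assoc] using this

theorem aux_tate (p : ℕ) [Fact p.Prime] (G : Type) [Group G] [Finite G]
    (hno : ¬ ∃ N : Subgroup G, ∃ _ : N.Normal, ¬ p ∣ Nat.card N ∧ IsPGroup p (G ⧸ N))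
    (P : Sylow p G) :
    ∃ ν : P →* ℂˣ, ∀ l : G →* ℂˣ, ∃ x : P, l x ≠ ν x := by
  classical
  have hp : p.Prime := Fact.out
  let X : Set G := {g | (orderOf g).Coprime p}
  let N : Subgroup G := Subgroup.normalClosure X
  have hN : IsPGroup p (G ⧸ N) := by
    intro g
    induction g using QuotientGroup.induction_on with
    | H g =>
      obtain ⟨k, m, hm, hkm⟩ := Nat.exists_eq_pow_mul_and_not_dvd (orderOf_pos g).ne' p hp.ne_one
      refine ⟨k, ?_⟩
      rw [← QuotientGroup.mk_pow, QuotientGroup.eq_one_iff]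
      refine Subgroup.subset_normalClosure ?_
      change (orderOf (g ^ p ^ k)).Coprime p
      have h1 : orderOf (g ^ p ^ k) ∣ m := by
        apply orderOf_dvd_of_pow_eq_one
        rw [← pow_mul, ← hkm, pow_orderOf_eq_one]
      exact Nat.Coprime.coprime_dvd_left h1 ((Nat.Prime.coprime_iff_not_dvd hp).2 hm).symm
  have hkill : ∀ (E : Type) [Group E] (f : G →* E), (∀ g ∈ X, f g = 1) → ∀ g ∈ N, f g = 1 := by
    intro E _ f hf g hg
    have : N ≤ f.ker := Subgroup.normalClosure_le_normal (fun g hg => hf g hg)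
    exact this hg
  let Q : Subgroup P := N.subgroupOf P
  have hQ : Q ≠ ⊥ := by
    intro hQ
    apply hno
    refine ⟨N, inferInstance, ?_, hN⟩
    intro hdvd
    obtain ⟨x, hx⟩ := exists_prime_orderOf_dvd_card' p hdvd
    have hpx : IsPGroup p (Subgroup.zpowers (x : G)) := by
      apply IsPGroup.of_card (n := 1)
      rw [Nat.card_zpowers, pow_one, Subgroup.orderOf_coe, hx]
    obtain ⟨P', hP'⟩ := hpx.exists_le_sylow
    obtain ⟨g, hg⟩ := MulAction.exists_smul_eq G P' P
    have h1 : g * x * g⁻¹ ∈ P := by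
      rw [← hg]
      have := Subgroup.smul_mem_pointwise_smul (x : G) (MulAut.conj g) (P' : Subgroup G)
        (hP' (Subgroup.mem_zpowers _))
      exact this
    have h2 : g * x * g⁻¹ ∈ N := (inferInstance : N.Normal).conj_mem _ x.2 g
    have h3 : (⟨_, h1⟩ : P) ∈ Q := h2
    rw [hQ, Subgroup.mem_bot] at h3
    have h4 : g * x * g⁻¹ = 1 := congrArg Subtype.val h3
    have h5 : (x : G) = 1 := by simpa using h4
    have h6 : x = 1 := by exact_mod_cast h5
    rw [h6, orderOf_one] at hx
    exact hp.one_lt.ne hx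
  let R : Subgroup P := ⁅Q, ⊤⁆
  have hQR : ¬ Q ≤ R := by
    intro hQR
    apply hQ
    have hnil : Group.IsNilpotent P := P.isPGroup'.isNilpotent
    obtain ⟨n, hn⟩ := Subgroup.nilpotent_iff_lowerCentralSeries.1 hnil
    have : ∀ n, Q ≤ Subgroup.lowerCentralSeries (⊤ : Subgroup P) n := by
      intro n
      induction n with
      | zero => simp
      | succ n ih => exact hQR.trans (Subgroup.commutator_mono ih le_top)
    exact le_bot_iff.1 (hn ▸ this n)
  obtain ⟨q, hqQ, hqR⟩ := SetLike.not_le_iff_exists.1 hQR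
  let E := P ⧸ R
  have hE : IsPGroup p E := P.isPGroup'.to_quotient R
  let mk : P →* E := QuotientGroup.mk' R
  have hcen : ∀ x ∈ Q, mk x ∈ Subgroup.center E := by
    intro x hx
    rw [Subgroup.mem_center_iff]
    intro e
    obtain ⟨y, rfl⟩ := QuotientGroup.mk'_surjective R e
    change mk y * mk x = mk x * mk y
    rw [← map_mul, ← map_mul]
    refine QuotientGroup.eq.2 ?_
    have := Subgroup.commutator_mem_commutator (inv_mem hx) (Subgroup.mem_top (y⁻¹ : P))
    simpa [R, commutatorElement_def, mul_assoc] using this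
  have hsup : (P : Subgroup G) ⊔ N = ⊤ := by
    rw [← Subgroup.index_eq_one]
    have h1 : ((P : Subgroup G) ⊔ N).index ∣ (P : Subgroup G).index :=
      Subgroup.index_dvd_of_le le_sup_left
    have h2 : ((P : Subgroup G) ⊔ N).index ∣ N.index := Subgroup.index_dvd_of_le le_sup_right
    obtain ⟨n, hn⟩ := IsPGroup.iff_card.1 hN
    rw [Subgroup.index_eq_card N, hn] at h2
    have h3 : ¬ p ∣ (P : Subgroup G).index := P.not_dvd_index
    have h4 : (P : Subgroup G).index.Coprime (p ^ n) :=
      ((Nat.Prime.coprime_iff_not_dvd hp).2 h3).symm.pow_right n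
    exact Nat.eq_one_of_dvd_coprimes h4 h1 h2
  have hsur : ∀ g : G, ∃ x : P, (x : G)⁻¹ * g ∈ N := by
    intro g
    have : g ∈ (P : Subgroup G) ⊔ N := hsup ▸ trivial
    obtain ⟨x, hx, n, hn, rfl⟩ := Subgroup.mem_sup_of_normal_right.1 this
    exact ⟨⟨x, hx⟩, by simpa using hn⟩
  choose σ hσ using hsur
  have hσ' : ∀ g, ((σ g : G) : G ⧸ N) = (g : G ⧸ N) := fun g => QuotientGroup.eq.2 (hσ g)
  obtain ⟨τ, hτ⟩ := aux_lift_hom (P : Subgroup G) (E := E) (by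
      obtain ⟨n, hn⟩ := IsPGroup.iff_card.1 hE
      rw [hn]
      exact ((Nat.Prime.coprime_iff_not_dvd hp).2 P.not_dvd_index).symm.pow_right n)
    mk (fun g => mk (σ g)) (by
      intro g l
      rw [← map_inv, ← map_mul, ← map_mul]
      apply hcen
      change (((σ (g * l))⁻¹ * σ g * σ l : P) : G) ∈ N
      rw [← QuotientGroup.eq_one_iff]
      push_cast
      simp only [hσ', QuotientGroup.mk_mul, QuotientGroup.mk_inv]
      group) (by
      intro x
      rw [← map_inv, ← map_mul]
      exact hcen _ (hσ x))
  have hτN : ∀ g ∈ N, τ g = 1 := by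
    apply hkill
    intro g hg
    obtain ⟨k, hk⟩ := hE (τ g)
    have h1 : orderOf (τ g) ∣ p ^ k := orderOf_dvd_of_pow_eq_one hk
    have h2 : orderOf (τ g) ∣ orderOf g := orderOf_map_dvd τ g
    rw [← orderOf_eq_one_iff]
    exact Nat.eq_one_of_dvd_coprimes (Nat.Coprime.pow_right k hg) h2 h1
  have hφc : ∀ x : P, mk x * (τ x)⁻¹ ∈ Subgroup.center E := by
    intro x
    have h1 := hτ x
    have h2 : (mk (σ x))⁻¹ * mk x ∈ Subgroup.center E := by
      rw [← map_inv, ← map_mul]; exact hcen _ (hσ x)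
    have h3 := mul_mem h2 (inv_mem h1)
    rw [← (inferInstance : (Subgroup.center E).Normal).mem_comm_iff] at h3
    rw [(inferInstance : (Subgroup.center E).Normal).mem_comm_iff]
    simpa [mul_assoc] using h3
  let _ : CommGroup (Subgroup.center E) :=
    { (inferInstance : Group (Subgroup.center E)) with
      mul_comm := fun a b => Subtype.ext (Subgroup.mem_center_iff.mp b.2 a) }
  let φ : P →* Subgroup.center E := MonoidHom.mk' (fun x => ⟨_, hφc x⟩) (by
    intro x y
    ext
    change mk (x * y) * (τ ((x * y : P) : G))⁻¹ = mk x * (τ x)⁻¹ * (mk y * (τ y)⁻¹)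
    rw [mul_assoc (mk x), Subgroup.mem_center_iff.1 (hφc y)]
    simp [mul_assoc])
  have hφq : φ q ≠ 1 := by
    intro h
    have h1 : mk q * (τ q)⁻¹ = 1 := congrArg Subtype.val h
    rw [hτN q hqQ, inv_one, mul_one] at h1
    exact hqR ((QuotientGroup.eq_one_iff q).1 h1)
  obtain ⟨χ, hχ⟩ := CommGroup.exists_apply_ne_one_of_hasEnoughRootsOfUnity
    (Subgroup.center E) ℂ hφq
  refine ⟨χ.comp φ, fun l => ⟨q, ?_⟩⟩
  suffices l q = 1 by
    rw [this]; exact hχ.symm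
  obtain ⟨k, m, hm, hkm⟩ := Nat.exists_eq_pow_mul_and_not_dvd (Nat.card_pos (α := G)).ne' p hp.ne_one
  have h1 : (l ^ m) q = 1 := by
    apply hkill _ (l ^ m) _ _ hqQ
    intro g hg
    have : orderOf g ∣ p ^ k * m := hkm ▸ orderOf_dvd_natCard g
    have := (Nat.Coprime.pow_right k hg).dvd_of_dvd_mul_left this
    rw [MonoidHom.pow_apply, ← map_pow, orderOf_dvd_iff_pow_eq_one.1 this, map_one]
  obtain ⟨j, hj⟩ := P.isPGroup' q
  have h2 : orderOf (l q) ∣ p ^ j := by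
    apply orderOf_dvd_of_pow_eq_one
    rw [← map_pow, ← Subgroup.coe_pow, hj]; simp
  rw [← orderOf_eq_one_iff]
  refine Nat.eq_one_of_dvd_coprimes (Nat.Coprime.pow_right j ((Nat.Prime.coprime_iff_not_dvd hp).2 hm).symm) (orderOf_dvd_of_pow_eq_one h1) h2

theorem aux_ext {T : Type} [Group T] [Finite T] (P : Subgroup T) [hPn : P.Normal]
    (hcop : Nat.Coprime (Nat.card P) P.index) (ν : P →* ℂˣ)
    (hinv : ∀ (t : T) (x : P), ν ⟨t * x * t⁻¹, hPn.conj_mem _ x.2 t⟩ = ν x) :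
    ∃ n : T →* ℂˣ, ∀ x : P, n x = ν x := by
  obtain ⟨K, hK⟩ := Subgroup.exists_right_complement'_of_coprime hcop
  let e := SemidirectProduct.mulEquivSubgroup hK
  have e1 : ∀ x : P, e (SemidirectProduct.inl x) = x := by
    intro x
    simp [e, SemidirectProduct.mulEquivSubgroup, SemidirectProduct.monoidHomSubgroup]
  clear_value e
  refine ⟨(SemidirectProduct.lift ν (1 : K →* ℂˣ) ?_).comp e.symm.toMonoidHom, fun x => ?_⟩
  · intro k
    ext x
    have := hinv k x
    simp only [MonoidHom.comp_apply, MulEquiv.coe_toMonoidHom, MonoidHom.one_apply, map_one]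
    rw [← this]
    congr
  have : e.symm (x : T) = SemidirectProduct.inl x := by
    rw [MulEquiv.symm_apply_eq, e1]
  simp only [MonoidHom.comp_apply, MulEquiv.coe_toMonoidHom, this]
  exact SemidirectProduct.lift_inl _ _ _ x

/-- induced space -/
def auxInd {G : Type} [Group G] (T : Subgroup G) (n : T →* ℂˣ) : Submodule ℂ (G → ℂ) where
  carrier := {f | ∀ (t : T) (g : G), f (t * g) = n t * f g}
  add_mem' := by
    intro a b ha hb t g
    simp only [Pi.add_apply, ha t g, hb t g, mul_add]
  zero_mem' := by intro t g; simp
  smul_mem' := by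
    intro c a ha t g
    simp only [Pi.smul_apply, ha t g, smul_eq_mul]; ring

theorem auxInd_finrank {G : Type} [Group G] [Finite G] (T : Subgroup G) (n : T →* ℂˣ) :
    finrank ℂ (auxInd T n) = T.index := by
  have hu : ∀ g : G, g * (QuotientGroup.mk g⁻¹ : G ⧸ T).out ∈ T := fun g => by
    have : ((g⁻¹)⁻¹ * (QuotientGroup.mk g⁻¹ : G ⧸ T).out) ∈ T := by
      rw [← QuotientGroup.eq]; simp
    simpa using this
  have : Fintype (G ⧸ T) := Fintype.ofFinite _
  let e : auxInd T n ≃ₗ[ℂ] (G ⧸ T → ℂ) :=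
    { toFun := fun f q => f.1 (q.out)⁻¹
      map_add' := by intro a b; rfl
      map_smul' := by intro a b; rfl
      invFun := fun h => ⟨fun g => n ⟨_, hu g⟩ * h (QuotientGroup.mk g⁻¹), by
        intro t g
        have h1 : (QuotientGroup.mk (t * g)⁻¹ : G ⧸ T) = QuotientGroup.mk g⁻¹ := by
          rw [QuotientGroup.eq]; simp
        have h2 : (⟨_, hu (t * g)⟩ : T) = t * ⟨_, hu g⟩ := by
          ext; simp only [h1, Subgroup.coe_mul, mul_assoc]
        change (n ⟨_, hu (t * g)⟩ : ℂ) * h (QuotientGroup.mk (t * g)⁻¹) =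
          n t * (n ⟨_, hu g⟩ * h (QuotientGroup.mk g⁻¹))
        rw [h2, h1, map_mul, Units.val_mul, mul_assoc]⟩
      left_inv := by
        intro f
        ext g
        have := f.2 ⟨_, hu g⟩ (QuotientGroup.mk g⁻¹ : G ⧸ T).out⁻¹
        simp only [mul_inv_cancel_right] at this
        exact this.symm
      right_inv := by
        intro h
        ext q
        have h1 : (QuotientGroup.mk ((q.out)⁻¹)⁻¹ : G ⧸ T) = q := by simp
        have h2 : (⟨_, hu (q.out)⁻¹⟩ : T) = 1 := by
          ext; simp
        change (n ⟨_, hu (q.out)⁻¹⟩ : ℂ) * h (QuotientGroup.mk ((q.out)⁻¹)⁻¹) = h q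
        rw [h2, h1, map_one, Units.val_one, one_mul] }
  rw [e.finrank_eq, Module.finrank_fintype_fun_eq_card, Subgroup.index_eq_card,
    Nat.card_eq_fintype_card]

def auxIndRep {G : Type} [Group G] (T : Subgroup G) (n : T →* ℂˣ) :
    Representation ℂ G (auxInd T n) where
  toFun g :=
    { toFun := fun f => ⟨fun x => f.1 (x * g), fun t x => by
      change f.1 (t * x * g) = n t * f.1 (x * g)
      rw [mul_assoc]; exact f.2 t _⟩
      map_add' := by intro a b; rfl
      map_smul' := by intro a b; rfl }
  map_one' := by ext f x; simp
  map_mul' := by intro a b; ext f x; simp [mul_assoc]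

theorem aux_irr {G W : Type} [Group G] [Finite G] [AddCommGroup W] [Module ℂ W]
    [FiniteDimensional ℂ W] (ρ : Representation ℂ G W) (p : ℕ) (h : ¬ p ∣ finrank ℂ W) :
    ∃ U : Subrepresentation ρ, ¬ p ∣ finrank ℂ U.toSubmodule ∧
      U.toRepresentation.IsIrreducible := by
  classical
  have hex : ∃ m, ∃ U : Subrepresentation ρ, ¬ p ∣ finrank ℂ U.toSubmodule ∧
      finrank ℂ U.toSubmodule = m :=
    ⟨_, ⊤, by
      have : (⊤ : Subrepresentation ρ).toSubmodule = ⊤ := rfl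
      rw [this, finrank_top]; exact h, rfl⟩
  obtain ⟨U, hU, hUm⟩ := Nat.find_spec hex
  refine ⟨U, hU, ?_⟩
  have hmin : ∀ C : Subrepresentation ρ, ¬ p ∣ finrank ℂ C.toSubmodule →
      finrank ℂ U.toSubmodule ≤ finrank ℂ C.toSubmodule := by
    intro C hC
    rw [hUm]
    exact Nat.find_min' hex ⟨C, hC, rfl⟩
  have hpos : 0 < finrank ℂ U.toSubmodule := by
    rcases Nat.eq_zero_or_pos (finrank ℂ U.toSubmodule) with h0 | h0
    · rw [h0] at hU; exact absurd (dvd_zero p) hU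
    · exact h0
  have hnt : Nontrivial U.toSubmodule := Module.nontrivial_of_finrank_pos hpos
  have hsub : ∀ C : Subrepresentation ρ, C.toSubmodule ≤ U.toSubmodule →
      C.toSubmodule = ⊥ ∨ C.toSubmodule = U.toSubmodule := by
    intro C hC
    have hcl : ComplementedLattice (Subrepresentation ρ) := inferInstance
    obtain ⟨D, hD⟩ := hcl.exists_isCompl C
    have hinf : C.toSubmodule ⊓ D.toSubmodule = ⊥ := by
      have := hD.inf_eq_bot
      exact congrArg Subrepresentation.toSubmodule this
    have hsup : C.toSubmodule ⊔ D.toSubmodule = ⊤ := by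
      have := hD.sup_eq_top
      exact congrArg Subrepresentation.toSubmodule this
    have h1 : C.toSubmodule ⊔ (D ⊓ U).toSubmodule = U.toSubmodule := by
      change C.toSubmodule ⊔ D.toSubmodule ⊓ U.toSubmodule = _
      rw [← sup_inf_assoc_of_le _ hC, hsup, top_inf_eq]
    have h2 : C.toSubmodule ⊓ (D ⊓ U).toSubmodule = ⊥ := by
      change C.toSubmodule ⊓ (D.toSubmodule ⊓ U.toSubmodule) = _
      rw [← inf_assoc, hinf, bot_inf_eq]
    have h3 := Submodule.finrank_sup_add_finrank_inf_eq C.toSubmodule (D ⊓ U).toSubmodule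
    rw [h1, h2, finrank_bot, add_zero] at h3
    by_cases hpC : p ∣ finrank ℂ C.toSubmodule
    · have hpD : ¬ p ∣ finrank ℂ (D ⊓ U).toSubmodule := by
        intro hd
        exact hU (h3 ▸ dvd_add hpC hd)
      have := hmin _ hpD
      left
      apply Submodule.finrank_eq_zero.1
      omega
    · right
      exact Submodule.eq_of_le_of_finrank_le hC (hmin _ hpC)
  have : Nontrivial (Subrepresentation U.toRepresentation) := by
    refine ⟨⊥, ⊤, fun h => ?_⟩
    have : (⊥ : Submodule ℂ U.toSubmodule) = ⊤ := congrArg Subrepresentation.toSubmodule h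
    exact bot_ne_top this
  refine { eq_bot_or_eq_top := fun C => ?_ }
  let C' : Subrepresentation ρ :=
    { toSubmodule := C.toSubmodule.map U.toSubmodule.subtype
      apply_mem_toSubmodule := by
        rintro g _ ⟨v, hv, rfl⟩
        exact ⟨_, C.apply_mem_toSubmodule g hv, rfl⟩ }
  rcases hsub C' (Submodule.map_subtype_le _ _) with h0 | h0
  · left
    apply Subrepresentation.toSubmodule_injective
    apply Submodule.map_injective_of_injective U.toSubmodule.injective_subtype
    change C'.toSubmodule = Submodule.map _ ⊥
    rw [h0, Submodule.map_bot]
  · right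
    apply Subrepresentation.toSubmodule_injective
    apply Submodule.map_injective_of_injective U.toSubmodule.injective_subtype
    change C'.toSubmodule = Submodule.map _ ⊤
    rw [h0, Submodule.map_subtype_top]

theorem aux_exists_simple {G : Type} [Group G] [Finite G] (T : Subgroup G) (n : T →* ℂˣ) (p : ℕ)
    (h : ¬ p ∣ T.index) :
    ∃ V : FDRep ℂ G, Simple V ∧ ¬ p ∣ finrank ℂ V ∧ ∃ l : V →ₗ[ℂ] ℂ, l ≠ 0 ∧
      ∀ (t : T) (v : V), l (V.ρ t v) = n t * l v := by
  classical
  have : Fintype G := Fintype.ofFinite _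
  have : Invertible (Nat.card G : ℂ) := invertibleOfNonzero (by simp)
  obtain ⟨U, hU, hirr⟩ := aux_irr (auxIndRep T n) p (by rwa [auxInd_finrank])
  refine ⟨FDRep.of (V := U.toSubmodule) U.toRepresentation, ?_, hU, ?_⟩
  · rw [FDRep.simple_iff_char_is_norm_one]
    have := Representation.char_orthonormal (G := G) (k := ℂ) (V := U.toSubmodule) (W := U.toSubmodule)
      U.toRepresentation U.toRepresentation
    rw [if_pos ⟨Representation.Equiv.refl _⟩, inv_mul_eq_one₀ (by simp)] at this
    rw [this]
    rfl
  · let l : U.toSubmodule →ₗ[ℂ] ℂ :=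
      (LinearMap.proj (1 : G)).comp ((auxInd T n).subtype.comp U.toSubmodule.subtype)
    refine ⟨l, ?_, ?_⟩
    · intro hl
      have hz : ∀ f : U.toSubmodule, f = 0 := by
        intro f
        ext g
        have := LinearMap.congr_fun hl (U.toRepresentation g f)
        change f.1.1 (1 * g) = 0 at this
        rwa [one_mul] at this
      apply hU
      have : Subsingleton U.toSubmodule := ⟨fun a b => by rw [hz a, hz b]⟩
      rw [Module.finrank_zero_of_subsingleton]
      exact dvd_zero _
    · intro t f
      change f.1.1 (1 * t) = n t * f.1.1 1
      have := f.1.2 t 1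
      rw [one_mul]
      rwa [mul_one] at this

theorem aux_ded {H W ι : Type} [Group H] [AddCommGroup W] [Module ℂ W] [Fintype ι]
    (χ : ι → (H →* ℂˣ)) (hχ : Function.Injective χ) (L : ι → (W →ₗ[ℂ] ℂ)) (r : H → W → W)
    (hL : ∀ i h v, L i (r h v) = χ i h * L i v) (h0 : ∀ v, ∑ i, L i v = 0) (i : ι) : L i = 0 := by
  have h1 := (linearIndependent_monoidHom H ℂ).comp
    (fun i => (Units.coeHom ℂ).comp (χ i)) (by
      intro i j hij
      apply hχ
      ext h
      exact DFunLike.congr_fun hij h)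
  rw [Fintype.linearIndependent_iff] at h1
  ext v
  refine h1 (fun i => L i v) ?_ i
  ext h
  rw [Finset.sum_apply]
  rw [Pi.zero_apply, ← h0 (r h v)]
  refine Finset.sum_congr rfl fun i _ => ?_
  rw [hL, mul_comm]
  rfl

theorem aux_S_le {G W : Type} [Group G] [Finite G] [AddCommGroup W] [Module ℂ W]
    [FiniteDimensional ℂ W] (ρ : G →* (W →ₗ[ℂ] W)) (P : Subgroup G) (ν : P →* ℂˣ)
    (T : Subgroup G)
    (hT : ∀ b : (Subgroup.normalizer (P : Set G)), (b : G) ∈ T ↔ ν.comp (P.normalizerMonoidHom b).toMonoidHom = ν)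
    (n : T →* ℂˣ) (hn : ∀ (x : P) (t : T), (t : G) = x → n t = ν x)
    (hPT : P ≤ T)
    (l : W →ₗ[ℂ] ℂ) (hl0 : l ≠ 0) (hl : ∀ (t : T) (v : W), l (ρ t v) = n t * l v)
    (S : Finset (G →* ℂˣ)) (f : (G →* ℂˣ) → (W ≃ₗ[ℂ] W))
    (hf : ∀ m ∈ S, ∀ g v, f m (ρ g v) = (m g : ℂ) • ρ g (f m v))
    (hSP : ∀ m ∈ S, ∀ x ∈ P, m x = 1)
    (hSB : ∀ m ∈ S, ∀ m' ∈ S, (∀ b ∈ (Subgroup.normalizer (P : Set G)), m b = m' b) → m = m') :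
    S.card ≤ finrank ℂ W := by
  classical
  let B := (Subgroup.normalizer (P : Set G))
  let c : B → (P →* ℂˣ) := fun b => ν.comp (P.normalizerMonoidHom b).toMonoidHom
  have hcT : ∀ b b' : B, c b = c b' → ((b * b'⁻¹ : B) : G) ∈ T := by
    intro b b' h
    rw [hT]
    ext x
    have := DFunLike.congr_fun h (P.normalizerMonoidHom b'⁻¹ x)
    simp only [c, MonoidHom.comp_apply, MulEquiv.coe_toMonoidHom] at this
    rw [← MulAut.mul_apply, ← map_mul, ← MulAut.mul_apply, ← map_mul, mul_inv_cancel, map_one] at this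
    simpa using congrArg Units.val this
  have : Fintype (Set.range c) := Fintype.ofFinite _
  let b : Set.range c → B := fun ω => ω.2.choose
  have hb : ∀ ω, c (b ω) = ω := fun ω => ω.2.choose_spec
  let res : (G →* ℂˣ) → (T →* ℂˣ) := fun m => m.comp T.subtype
  -- first bound
  have key1 : Fintype.card (Set.range c) * (S.image res).card ≤ finrank ℂ W := by
    have hch : ∀ μ : S.image res, ∃ m ∈ S, res m = μ := fun μ => by
      exact Finset.mem_image.1 μ.2
    choose m hmS hm using hch
    have hli : LinearIndependent ℂ (fun q : Set.range c × S.image res =>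
        (l.comp ((f (m q.2)).toLinearMap.comp (ρ (b q.1))) : W →ₗ[ℂ] ℂ)) := by
      rw [Fintype.linearIndependent_iff]
      intro a ha
      have step1 := aux_ded (H := P) (W := W) (ι := Set.range c) (fun ω => (ω : P →* ℂˣ))
        Subtype.val_injective
        (fun ω => ∑ μ : S.image res, a (ω, μ) •
          (l.comp ((f (m μ)).toLinearMap.comp (ρ (b ω))) : W →ₗ[ℂ] ℂ))
        (fun x v => ρ x v) (by
          intro ω x v
          simp only [LinearMap.sum_apply, LinearMap.smul_apply, LinearMap.comp_apply,
            LinearEquiv.coe_coe, Finset.mul_sum]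
          refine Finset.sum_congr rfl fun μ _ => ?_
          have e1 : ρ (b ω) (ρ x v) = ρ (P.normalizerMonoidHom (b ω) x) (ρ (b ω) v) := by
            rw [← Module.End.mul_apply, ← map_mul, ← Module.End.mul_apply, ← map_mul]
            simp
          rw [e1, hf _ (hmS μ), hSP _ (hmS μ) _ (Subtype.mem _)]
          have e2 := hl ⟨_, hPT (P.normalizerMonoidHom (b ω) x).2⟩ ((f (m μ)) (ρ (b ω) v))
          rw [hn (P.normalizerMonoidHom (b ω) x) _ rfl] at e2
          simp only [Units.val_one, one_smul]
          rw [e2]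
          have e3 : ν (P.normalizerMonoidHom (b ω) x) = ω.1 x := by
            rw [← hb ω]; rfl
          rw [e3, smul_eq_mul, smul_eq_mul]
          ring) (by
          intro v
          have := LinearMap.congr_fun ha v
          rw [Fintype.sum_prod_type] at this
          simpa [LinearMap.sum_apply] using this)
      rintro ⟨ω, μ⟩
      have step2 := aux_ded (H := T) (W := W) (ι := S.image res) (fun μ => n * μ.1)
        (fun μ μ' h => Subtype.ext (mul_left_cancel h))
        (fun μ => a (ω, μ) • (l.comp (f (m μ)).toLinearMap : W →ₗ[ℂ] ℂ))
        (fun x v => ρ x v) (by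
          intro μ t v
          simp only [LinearMap.smul_apply, LinearMap.comp_apply, LinearEquiv.coe_coe]
          rw [hf _ (hmS μ), map_smul, hl]
          have : m μ t = μ.1 t := by rw [← hm μ]; rfl
          rw [this, smul_eq_mul, smul_eq_mul, smul_eq_mul, MonoidHom.mul_apply, Units.val_mul]
          ring) (by
          intro v
          have := LinearMap.congr_fun (step1 ω) (ρ ((b ω : G)⁻¹) v)
          have e1 : ρ (b ω) (ρ ((b ω : G)⁻¹) v) = v := by
            rw [← Module.End.mul_apply, ← map_mul, mul_inv_cancel, map_one, Module.End.one_apply]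
          simpa [LinearMap.sum_apply, e1] using this) μ
      by_contra hne
      apply hl0
      rcases smul_eq_zero.1 step2 with h | h
      · exact absurd h hne
      · ext v
        have := LinearMap.congr_fun h ((f (m μ)).symm v)
        simpa using this
    have := hli.fintype_card_le_finrank
    rw [Fintype.card_prod, Fintype.card_coe, Subspace.dual_finrank_eq] at this
    exact this
  have key2 : S.card ≤ Fintype.card (Set.range c) * (S.image res).card := by
    refine Finset.card_le_mul_card_image _ _ fun μ hμ => ?_
    have hli : LinearIndependent ℂ
        (fun (m : {m ∈ S | res m = μ}) (ω : Set.range c) => (m.1 (b ω) : ℂ)) := by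
      have h1 := (linearIndependent_monoidHom B ℂ).comp
        (fun m : {m ∈ S | res m = μ} => (Units.coeHom ℂ).comp (m.1.comp B.subtype)) (by
          intro i j hij
          apply Subtype.ext
          have hi := (Finset.mem_filter.1 i.2).1
          have hj := (Finset.mem_filter.1 j.2).1
          refine hSB _ hi _ hj fun x hx => ?_
          ext
          exact DFunLike.congr_fun hij ⟨x, hx⟩)
      rw [Fintype.linearIndependent_iff] at h1 ⊢
      intro a ha
      refine h1 a ?_
      ext x
      have h2 := congrFun ha ⟨c x, x, rfl⟩
      set ω : Set.range c := ⟨c x, x, rfl⟩ with hω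
      rw [Finset.sum_apply] at h2 ⊢
      have h3 := hcT x (b ω) (hb ω).symm
      have h4 : ∀ m : {m ∈ S | res m = μ}, m.1 x = μ ⟨_, h3⟩ * m.1 (b ω) := by
        intro m
        have h6 := DFunLike.congr_fun (Finset.mem_filter.1 m.2).2 ⟨_, h3⟩
        rw [← h6]
        change m.1 x = m.1 _ * _
        rw [← map_mul]
        simp
      have h5 := congrArg (fun z => (μ ⟨_, h3⟩ : ℂ) * z) h2
      simp only [Finset.mul_sum, Pi.zero_apply, mul_zero, Pi.smul_apply, smul_eq_mul] at h5
      rw [Pi.zero_apply, ← h5]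
      refine Finset.sum_congr rfl fun m _ => ?_
      change a m * (m.1 x : ℂ) = _
      rw [h4, Units.val_mul]
      ring
    have := hli.fintype_card_le_finrank
    rw [Fintype.card_coe, Module.finrank_fintype_fun_eq_card] at this
    exact this
  exact key2.trans key1

def auxTwist {G : Type} [Group G] (V : FDRep ℂ G) (m : G →* ℂˣ) : FDRep ℂ G :=
  FDRep.of (V := V) (
    { toFun := fun g => (m g : ℂ) • V.ρ g
      map_one' := by simp
      map_mul' := by
        intro a b
        ext v
        simp only [map_mul, Units.val_mul, LinearMap.smul_apply, Module.End.mul_apply, map_smul,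
          smul_smul]
        rw [mul_comm] } : G →* (V →ₗ[ℂ] V))

theorem auxTwist_rho {G : Type} [Group G] (V : FDRep ℂ G) (m : G →* ℂˣ) (g : G) :
    (auxTwist V m).ρ g = (m g : ℂ) • V.ρ g := rfl

theorem auxTwist_char {G : Type} [Group G] (V : FDRep ℂ G) (m : G →* ℂˣ) (g : G) :
    (auxTwist V m).character g = m g * V.character g := by
  have : (auxTwist V m).character g = LinearMap.trace ℂ V ((m g : ℂ) • V.ρ g) := rfl
  rw [this, map_smul]
  rfl

theorem auxTwist_simple {G : Type} [Group G] [Finite G] (V : FDRep ℂ G) (m : G →* ℂˣ)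
    (h : Simple V) : Simple (auxTwist V m) := by
  have : Fintype G := Fintype.ofFinite _
  rw [FDRep.simple_iff_char_is_norm_one] at h ⊢
  rw [← h]
  refine Finset.sum_congr rfl fun g _ => ?_
  rw [auxTwist_char, auxTwist_char]
  have : (m g : ℂ) * m g⁻¹ = 1 := by rw [← Units.val_mul, ← map_mul]; simp
  linear_combination (V.character g * V.character g⁻¹) * this

theorem aux_iso {G : Type} [Group G] [Finite G] (V W : FDRep ℂ G) (hV : Simple V) (hW : Simple W)
    (h : V.character = W.character) : Nonempty (V ≅ W) := by
  classical
  have : Fintype G := Fintype.ofFinite _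
  have : Invertible (Nat.card G : ℂ) := invertibleOfNonzero (by simp)
  have h1 := FDRep.char_orthonormal V V
  have h2 := FDRep.char_orthonormal V W
  rw [if_pos ⟨Iso.refl V⟩] at h1
  rw [← h, h1] at h2
  by_contra hne
  rw [if_neg hne] at h2
  exact one_ne_zero h2

theorem aux_twist_equiv {G : Type} [Group G] [Finite G] (V : FDRep ℂ G) (hV : Simple V)
    (m : G →* ℂˣ) (h : ∀ g, m g * V.character g = V.character g) :
    ∃ f : V ≃ₗ[ℂ] V, ∀ g v, f (V.ρ g v) = (m g : ℂ) • V.ρ g (f v) := by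
  obtain ⟨i⟩ := aux_iso V (auxTwist V m) hV (auxTwist_simple V m hV) (by
    ext g; rw [auxTwist_char, h])
  let f : V ≃ₗ[ℂ] V := FDRep.isoToLinearEquiv (V := V) (W := auxTwist V m) i
  refine ⟨f, fun g v => ?_⟩
  have h1 : (m g : ℂ) • V.ρ g = f.conj (V.ρ g) := FDRep.Iso.conj_ρ i g
  have h2 := LinearMap.congr_fun h1 (f v)
  rw [LinearMap.smul_apply] at h2
  rw [h2, LinearEquiv.conj_apply_apply, LinearEquiv.symm_apply_apply]

theorem aux_twist_pow {G : Type} [Group G] (V : FDRep ℂ G)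
    (m : G →* ℂˣ) (f : V ≃ₗ[ℂ] V) (h : ∀ g v, f (V.ρ g v) = (m g : ℂ) • V.ρ g (f v)) (g : G) :
    m g ^ finrank ℂ V = 1 := by
  have h1 : f.conj (V.ρ g) = (m g : ℂ) • V.ρ g := by
    ext v
    rw [LinearEquiv.conj_apply_apply, h, LinearEquiv.apply_symm_apply]
    rfl
  have h2 := congrArg LinearMap.det h1
  rw [LinearEquiv.conj_apply, LinearMap.comp_assoc, LinearMap.det_conj, LinearMap.det_smul] at h2
  have h3 : LinearMap.det (V.ρ g) ≠ 0 := by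
    intro h0
    have : LinearMap.det (V.ρ g) * LinearMap.det (V.ρ g⁻¹) = 1 := by
      rw [← map_mul, ← map_mul]; simp
    rw [h0, zero_mul] at this
    exact zero_ne_one this
  ext
  push_cast
  exact (mul_eq_right₀ h3).1 h2.symm

/-- determinant character -/
def auxDet {G : Type} [Group G] (V : FDRep ℂ G) : G →* ℂˣ :=
  (LinearMap.det.comp V.ρ).toHomUnits

theorem auxDet_apply {G : Type} [Group G] (V : FDRep ℂ G) (h : finrank ℂ V = 1) (g : G) (v : V) :
    V.ρ g v = (auxDet V g : ℂ) • v := by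
  have h1 : (auxDet V g : ℂ) = LinearMap.det (V.ρ g) := rfl
  rw [h1]
  obtain ⟨c, hc, -⟩ := LinearMap.existsUnique_eq_smul_id_of_finrank_eq_one h (V.ρ g)
  rw [hc, LinearMap.det_smul, h]
  simp

theorem auxDet_char {G : Type} [Group G] (V : FDRep ℂ G) (h : finrank ℂ V = 1) (g : G) :
    V.character g = auxDet V g := by
  have : V.ρ g = (auxDet V g : ℂ) • LinearMap.id := by
    ext v
    rw [auxDet_apply V h]; rfl
  have h2 : V.character g = LinearMap.trace ℂ V (V.ρ g) := rfl
  rw [h2, this, map_smul, LinearMap.trace_id, h]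
  simp

theorem aux_hom_finite (G : Type) [Group G] [Finite G] : Finite (G →* ℂˣ) := by
  have h1 := (linearIndependent_monoidHom G ℂ).comp
    (fun m : G →* ℂˣ => (Units.coeHom ℂ).comp m) (by
      intro i j hij
      ext h
      exact DFunLike.congr_fun hij h)
  exact h1.finite

theorem aux_irr_finite (p : ℕ) (G : Type) [Group G] [Finite G] : (IrrP' p G).Finite := by
  classical
  have : Fintype G := Fintype.ofFinite _
  have : Invertible (Nat.card G : ℂ) := invertibleOfNonzero (by simp)
  have hli : LinearIndependent ℂ (fun χ : IrrP' p G => (χ : G → ℂ)) := by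
    have hex : ∀ χ : IrrP' p G, ∃ V : FDRep ℂ G, Simple V ∧ χ.1 = V.character := by
      rintro ⟨χ, d, ⟨V, h1, h2, h3⟩, h4⟩
      exact ⟨V, h1, h2⟩
    choose V hV hχ using hex
    rw [linearIndependent_iff']
    intro s a ha χ hs
    have h1 : ∀ ψ : IrrP' p G, (Nat.card G : ℂ)⁻¹ * ∑ g : G, ψ.1 g * χ.1 g⁻¹ =
        if ψ = χ then 1 else 0 := by
      intro ψ
      have hs1 := hV ψ
      have hs2 := hV χ
      have h2 := FDRep.char_orthonormal (V ψ) (V χ)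
      rw [← hχ, ← hχ] at h2
      rw [h2]
      have h3 : Nonempty (V ψ ≅ V χ) ↔ ψ = χ := by
        constructor
        · rintro ⟨i⟩
          apply Subtype.ext
          rw [hχ, hχ, FDRep.char_iso i]
        · rintro rfl
          exact ⟨Iso.refl _⟩
      simp only [h3]
    have h2 : ∑ ψ ∈ s, a ψ * ((Nat.card G : ℂ)⁻¹ * ∑ g : G, ψ.1 g * χ.1 g⁻¹) = 0 := by
      have : ∀ g, ∑ ψ ∈ s, a ψ * ψ.1 g = 0 := fun g => by
        have := congrFun ha g
        simpa [Finset.sum_apply] using this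
      calc _ = (Nat.card G : ℂ)⁻¹ * ∑ g : G, (∑ ψ ∈ s, a ψ * ψ.1 g) * χ.1 g⁻¹ := by
            simp only [Finset.mul_sum, Finset.sum_mul]
            rw [Finset.sum_comm]
            refine Finset.sum_congr rfl fun g _ => Finset.sum_congr rfl fun ψ _ => by ring
        _ = 0 := by simp [this]
    simp only [h1, mul_ite, mul_one, mul_zero] at h2
    rw [Finset.sum_ite_eq' s χ a, if_pos hs] at h2
    exact h2
  have := hli.finite
  exact Set.toFinite _

theorem aux_core (p : ℕ) [Fact p.Prime] (G : Type) [Group G] [Finite G]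
    (hno : ¬ ∃ N : Subgroup G, ∃ _ : N.Normal, ¬ p ∣ Nat.card N ∧ IsPGroup p (G ⧸ N)) :
    ∃ V : FDRep ℂ G, Simple V ∧ ¬ p ∣ finrank ℂ V ∧ 2 ≤ finrank ℂ V ∧
      ∀ S : Finset (G →* ℂˣ), (∀ m ∈ S, ∀ g, m g * V.character g = V.character g) →
        S.card ≤ finrank ℂ V := by
  classical
  let P : Sylow p G := default
  obtain ⟨ν, hν⟩ := aux_tate p G hno P
  let B := Subgroup.normalizer ((P : Subgroup G) : Set G)
  let T' : Subgroup B :=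
    { carrier := {b | ν.comp ((P : Subgroup G).normalizerMonoidHom b).toMonoidHom = ν}
      one_mem' := by
        ext x; simp
      mul_mem' := by
        intro a b ha hb
        ext x
        have h1 := DFunLike.congr_fun ha ((P : Subgroup G).normalizerMonoidHom b x)
        have h2 := DFunLike.congr_fun hb x
        simp only [MonoidHom.comp_apply, MulEquiv.coe_toMonoidHom] at h1 h2 ⊢
        rw [map_mul, MulAut.mul_apply, h1, h2]
      inv_mem' := by
        intro a ha
        ext x
        have h1 := DFunLike.congr_fun ha ((P : Subgroup G).normalizerMonoidHom a⁻¹ x)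
        simp only [MonoidHom.comp_apply, MulEquiv.coe_toMonoidHom] at h1 ⊢
        rw [← h1, ← MulAut.mul_apply, ← map_mul]
        simp }
  let T : Subgroup G := T'.map B.subtype
  have hT : ∀ b : B, (b : G) ∈ T ↔
      ν.comp ((P : Subgroup G).normalizerMonoidHom b).toMonoidHom = ν := by
    intro b
    change (b : G) ∈ T'.map B.subtype ↔ b ∈ T'
    constructor
    · rintro ⟨c, hc, hcb⟩
      have : c = b := Subtype.ext hcb
      exact this ▸ hc
    · intro h; exact ⟨b, h, rfl⟩
  have hTB : T ≤ B := Subgroup.map_subtype_le T'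
  have hPT : (P : Subgroup G) ≤ T := by
    intro x hx
    have hxB : x ∈ B := Subgroup.le_normalizer hx
    rw [hT ⟨x, hxB⟩]
    ext y
    have : (P : Subgroup G).normalizerMonoidHom ⟨x, hxB⟩ y = ⟨x, hx⟩ * y * ⟨x, hx⟩⁻¹ := by
      ext; exact Subgroup.normalizerMonoidHom_apply_apply_coe _ _ _
    simp only [MonoidHom.comp_apply, MulEquiv.coe_toMonoidHom]
    rw [this, map_mul, map_mul, map_inv, mul_comm, inv_mul_cancel_left]
  clear_value T
  let PT : Subgroup T := (P : Subgroup G).subgroupOf T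
  have hPTn : PT.Normal := by
    refine ⟨fun x hx g => ?_⟩
    rw [Subgroup.mem_subgroupOf] at hx ⊢
    exact (Subgroup.mem_normalizer_iff.1 (hTB g.2) _).1 hx
  have hidx : ¬ p ∣ T.index := fun h =>
    P.not_dvd_index (h.trans (Subgroup.index_dvd_of_le hPT))
  have hcop : Nat.Coprime (Nat.card PT) PT.index := by
    have h1 : ¬ p ∣ PT.index := fun h =>
      P.not_dvd_index (h.trans (Subgroup.relIndex_dvd_index_of_le hPT))
    have h2 : IsPGroup p PT := P.isPGroup'.of_equiv (Subgroup.subgroupOfEquivOfLe hPT).symm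
    obtain ⟨k, hk⟩ := IsPGroup.iff_card.1 h2
    rw [hk]
    exact Nat.Coprime.pow_left _ ((Nat.Prime.coprime_iff_not_dvd Fact.out).2 h1)
  obtain ⟨n, hn⟩ := aux_ext PT hcop (ν.comp (Subgroup.subgroupOfEquivOfLe hPT).toMonoidHom) (by
    intro t x
    have h1 := DFunLike.congr_fun ((hT ⟨t, hTB t.2⟩).1 t.2) (Subgroup.subgroupOfEquivOfLe hPT x)
    simp only [MonoidHom.comp_apply, MulEquiv.coe_toMonoidHom] at h1 ⊢
    rw [← h1]
    congr 1)
  have hn' : ∀ (x : (P : Subgroup G)) (t : T), (t : G) = x → n t = ν x := by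
    intro x t htx
    have hxt : t ∈ PT := by rw [Subgroup.mem_subgroupOf, htx]; exact x.2
    rw [hn ⟨t, hxt⟩]
    simp only [MonoidHom.comp_apply, MulEquiv.coe_toMonoidHom]
    congr 1
    ext
    exact htx
  obtain ⟨V, hVs, hpV, l, hl0, hl⟩ := aux_exists_simple T n p hidx
  refine ⟨V, hVs, hpV, ?_, ?_⟩
  · have h0 : finrank ℂ V ≠ 0 := fun h => by rw [h] at hpV; exact hpV (dvd_zero p)
    have h1 : finrank ℂ V ≠ 1 := by
      intro h
      obtain ⟨x, hx⟩ := hν (auxDet V)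
      apply hx
      obtain ⟨v, hv⟩ : ∃ v, l v ≠ 0 := by
        by_contra hcon
        push Not at hcon
        exact hl0 (LinearMap.ext hcon)
      have h2 := hl ⟨x, hPT x.2⟩ v
      rw [auxDet_apply V h, map_smul, hn' x _ rfl, smul_eq_mul] at h2
      ext
      exact mul_right_cancel₀ hv h2
    omega
  · intro S hS
    have hex : ∀ m : G →* ℂˣ, ∃ f : V ≃ₗ[ℂ] V, m ∈ S →
        ∀ g v, f (V.ρ g v) = (m g : ℂ) • V.ρ g (f v) := by
      intro m
      by_cases hm : m ∈ S
      · obtain ⟨f, hf⟩ := aux_twist_equiv V hVs m (hS m hm)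
        exact ⟨f, fun _ => hf⟩
      · exact ⟨LinearEquiv.refl _ _, fun h => absurd h hm⟩
    choose f hf using hex
    have hSP : ∀ m ∈ S, ∀ x ∈ (P : Subgroup G), m x = 1 := by
      intro m hm x hx
      have h1 := aux_twist_pow V m (f m) (hf m hm) x
      obtain ⟨k, hk⟩ := P.isPGroup' ⟨x, hx⟩
      have hk' : x ^ p ^ k = 1 := congrArg Subtype.val hk
      have h2 : m x ^ p ^ k = 1 := by rw [← map_pow, hk', map_one]
      have h3 : Nat.Coprime (finrank ℂ V) (p ^ k) :=
        (Nat.Coprime.pow_left k ((Nat.Prime.coprime_iff_not_dvd Fact.out).2 hpV)).symm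
      have h4 := Nat.dvd_gcd (orderOf_dvd_of_pow_eq_one h1) (orderOf_dvd_of_pow_eq_one h2)
      rw [h3] at h4
      exact orderOf_eq_one_iff.1 (Nat.dvd_one.1 h4)
    refine aux_S_le V.ρ (P : Subgroup G) ν T hT n hn' hPT l hl0 hl S f hf hSP ?_
    intro m hm m' hm' hB
    have h1 : (P : Subgroup G) ≤ (m * m'⁻¹).ker := by
      intro x hx
      rw [MonoidHom.mem_ker, MonoidHom.mul_apply, MonoidHom.inv_apply, hSP m hm x hx,
        hSP m' hm' x hx]
      simp
    have h2 := Sylow.normalizer_sup_eq_top' P h1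
    have h3 : Subgroup.normalizer ((P : Subgroup G) : Set G) ≤ (m * m'⁻¹).ker := by
      intro x hx
      rw [MonoidHom.mem_ker, MonoidHom.mul_apply, MonoidHom.inv_apply, hB x hx]
      simp
    have h4 : (m * m'⁻¹).ker = ⊤ := by
      rw [← h2]
      exact (sup_eq_right.2 h3).symm
    rw [MonoidHom.ker_eq_top_iff] at h4
    exact mul_inv_eq_one.1 h4

/-- Theorem 1.1(ii): for an odd prime `p`, if `acd_{p'}(G) < 4/3` then `G` has a normal
`p`-complement. -/
theorem acd_p_prime_lt_four_thirds_normal_p_complement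
    (p : ℕ) (hp : p.Prime) (hodd : Odd p)
    (G : Type) [Group G] [Finite G] (h : acdP' p G < 4 / 3) :
    ∃ N : Subgroup G, ∃ _ : N.Normal, ¬ p ∣ Nat.card N ∧ IsPGroup p (G ⧸ N) := by
  classical
  have : Fact p.Prime := ⟨hp⟩
  by_contra hno
  obtain ⟨V, hVs, hpV, hd2, hS⟩ := aux_core p G hno
  have := aux_hom_finite G
  have : Fintype (G →* ℂˣ) := Fintype.ofFinite _
  set d := finrank ℂ V with hd
  let X := (aux_irr_finite p G).toFinset
  have hX : ∀ ψ, ψ ∈ X ↔ ψ ∈ IrrP' p G := fun ψ => Set.Finite.mem_toFinset _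
  let tw : (G →* ℂˣ) → (G → ℂ) := fun m g => m g * V.character g
  let O : Finset (G → ℂ) := Finset.univ.image tw
  have hOX : O ⊆ X := by
    intro ψ hψ
    obtain ⟨m, -, rfl⟩ := Finset.mem_image.1 hψ
    rw [hX]
    exact ⟨d, ⟨auxTwist V m, auxTwist_simple V m hVs, by ext g; rw [auxTwist_char], rfl⟩, hpV⟩
  have hO1 : ∀ ψ ∈ O, (ψ 1).re = d := by
    intro ψ hψ
    obtain ⟨m, -, rfl⟩ := Finset.mem_image.1 hψ
    simp [tw, FDRep.char_one, hd]
  have hAO : Fintype.card (G →* ℂˣ) ≤ d * O.card := by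
    rw [← Finset.card_univ]
    refine Finset.card_le_mul_card_image _ _ fun ψ hψ => ?_
    obtain ⟨m0, -, rfl⟩ := Finset.mem_image.1 hψ
    have h1 := hS (({m ∈ Finset.univ | tw m = tw m0} : Finset (G →* ℂˣ)).image
      (fun m => m0⁻¹ * m)) (by
        intro m hm g
        obtain ⟨m', hm', rfl⟩ := Finset.mem_image.1 hm
        have h2 := congrFun (Finset.mem_filter.1 hm').2 g
        simp only [tw] at h2
        rw [MonoidHom.mul_apply, MonoidHom.inv_apply, Units.val_mul, mul_assoc, h2,
          ← mul_assoc, ← Units.val_mul]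
        simp)
    rwa [Finset.card_image_of_injective _ (mul_right_injective _)] at h1
  let X1 := {ψ ∈ X | (ψ 1).re = 1}
  have hdeg : ∀ ψ ∈ X, ∃ W : FDRep ℂ G, ψ = W.character ∧ 1 ≤ finrank ℂ W ∧
      (ψ 1).re = finrank ℂ W := by
    intro ψ hψ
    rw [hX] at hψ
    obtain ⟨e, ⟨W, h1, h2, h3⟩, h4⟩ := hψ
    refine ⟨W, h2, ?_, ?_⟩
    · rw [h3]
      rcases Nat.eq_zero_or_pos e with h0 | h0
      · rw [h0] at h4; exact absurd (dvd_zero p) h4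
      · exact h0
    · rw [h2, FDRep.char_one]; simp
  have hX1 : X1.card ≤ Fintype.card (G →* ℂˣ) := by
    rw [← Finset.card_univ]
    refine (Finset.card_le_card (t := Finset.univ.image
      (fun (m : G →* ℂˣ) (g : G) => (m g : ℂ))) ?_).trans Finset.card_image_le
    intro ψ hψ
    obtain ⟨h1, h2⟩ := Finset.mem_filter.1 hψ
    obtain ⟨W, rfl, h3, h4⟩ := hdeg ψ h1
    rw [h2] at h4
    refine Finset.mem_image.2 ⟨auxDet W, Finset.mem_univ _, ?_⟩
    ext g
    rw [auxDet_char W (by exact_mod_cast h4.symm)]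
  have hd2' : (2 : ℝ) ≤ d := by exact_mod_cast hd2
  have hpt : ∀ ψ ∈ X, (if ψ ∈ O then (d : ℝ) else 0) - (if ψ ∈ X1 then 1 else 0) ≤
      3 * (ψ 1).re - 4 := by
    intro ψ hψ
    by_cases h1 : ψ ∈ X1
    · have h2 := (Finset.mem_filter.1 h1).2
      have h3 : ψ ∉ O := by
        intro h3
        have := hO1 ψ h3
        linarith
      rw [if_neg h3, if_pos h1, h2]
      norm_num
    · rw [if_neg h1]
      by_cases h3 : ψ ∈ O
      · rw [if_pos h3, hO1 ψ h3]
        linarith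
      · rw [if_neg h3]
        obtain ⟨W, h4, h5, h6⟩ := hdeg ψ hψ
        have h7 : finrank ℂ W ≠ 1 := by
          intro h7
          apply h1
          refine Finset.mem_filter.2 ⟨hψ, ?_⟩
          rw [h6, h7]; simp
        have h8 : 2 ≤ finrank ℂ W := by omega
        have h9 : (2 : ℝ) ≤ finrank ℂ W := by exact_mod_cast h8
        rw [h6]
        linarith
  have hsum := Finset.sum_le_sum hpt
  rw [Finset.sum_sub_distrib, Finset.sum_sub_distrib, ← Finset.sum_filter, ← Finset.sum_filter,
    Finset.filter_mem_eq_inter, Finset.filter_mem_eq_inter, Finset.inter_eq_right.2 hOX,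
    Finset.inter_eq_right.2 (Finset.filter_subset _ _), ← Finset.mul_sum] at hsum
  simp only [Finset.sum_const, nsmul_eq_mul, mul_one] at hsum
  have h1 : (X1.card : ℝ) ≤ d * O.card := by exact_mod_cast hX1.trans hAO
  have hXpos : 0 < X.card := by
    refine Finset.card_pos.2 ⟨V.character, ?_⟩
    rw [hX]
    exact ⟨d, ⟨V, hVs, rfl, rfl⟩, hpV⟩
  have hacd : acdP' p G = (∑ ψ ∈ X, (ψ 1).re) / X.card := by
    unfold acdP'
    rw [Set.ncard_eq_toFinset_card _ (aux_irr_finite p G),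
      finsum_mem_eq_finite_toFinset_sum _ (aux_irr_finite p G)]
  have hXpos' : (0 : ℝ) < X.card := by exact_mod_cast hXpos
  rw [hacd, div_lt_iff₀ hXpos'] at h
  linarith
end
end

section
/- Let G be a finite group. If acd_{ℝ,2'}(G) < 3/2, then G has a normal 2-complement. -/
open Module CategoryTheory

noncomputable section

/-- The field `ℝ`, viewed as a subfield of `ℂ`. -/
def realSubfield : Subfield ℂ := Complex.ofRealHom.fieldRange

/-- The set of irreducible complex characters of `G` whose degree is not divisible by `p`
and all of whose values lie in the subfield `F` of `ℂ`. -/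
def IrrFieldP' (p : ℕ) (G : Type) [Group G] (F : Subfield ℂ) : Set (G → ℂ) :=
  {χ | (∃ d, IsIrrCharDeg G χ d ∧ ¬ p ∣ d) ∧ ∀ g, χ g ∈ F}

/-- `acd_{F,p'}(G)`: the average of the degrees of the irreducible complex characters of `G`
whose degree is not divisible by `p` and all of whose values lie in `F`. -/
def acdFieldP' (p : ℕ) (G : Type) [Group G] (F : Subfield ℂ) : ℝ :=
  (∑ᶠ χ ∈ IrrFieldP' p G F, (χ 1).re) / (IrrFieldP' p G F).ncard


theorem lift_central (G : Type) [Group G] [Finite G] (P : Subgroup G) (hodd : Odd P.index)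
    (hE : ∀ δ : P →* ℤˣ, ∃ D : G →* ℤˣ, ∀ p : P, D p = δ p)
    (E : Type) [Group E] [Finite E] (Z : Subgroup E) [Z.Normal] (hZ : Z ≤ Subgroup.center E)
    (hZ2 : Nat.card Z = 2) (φ : G →* E ⧸ Z) (ψ : P →* E)
    (hφ : ∀ p : P, φ p = QuotientGroup.mk' Z (ψ p)) :
    ∃ Ψ : G →* E, ∀ p : P, Ψ p = ψ p := by
  have hc : ∀ z : Z, ∀ e : E, e * z = z * e := fun z e =>
    Subgroup.mem_center_iff.1 (hZ z.2) e
  let : CommGroup Z := { (inferInstance : Group Z) with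
    mul_comm := fun a b => Subtype.ext (hc b a) }
  have hsq : ∀ z : Z, z ^ 2 = 1 := fun z => by rw [← hZ2]; exact pow_card_eq_one'
  have hE' : ∀ δ : P →* Z, ∃ D : G →* Z, ∀ p : P, D p = δ p := by
    intro δ
    have : Fact (Nat.Prime 2) := ⟨Nat.prime_two⟩
    let κ : Z ≃* ℤˣ := mulEquivOfPrimeCardEq (p := 2) hZ2 (by simp)
    obtain ⟨D, hD⟩ := hE (κ.toMonoidHom.comp δ)
    refine ⟨κ.symm.toMonoidHom.comp D, fun p => ?_⟩
    simp [hD]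
  let Gh : Subgroup (G × E) :=
    (φ.comp (MonoidHom.fst G E)).eqLocus ((QuotientGroup.mk' Z).comp (MonoidHom.snd G E))
  have hGh : ∀ x : Gh, φ x.1.1 = QuotientGroup.mk' Z x.1.2 := fun x => x.2
  let π : Gh →* G := (MonoidHom.fst G E).comp Gh.subtype
  have hπ : Function.Surjective π := by
    intro g
    obtain ⟨e, he⟩ := QuotientGroup.mk'_surjective Z (φ g)
    exact ⟨⟨(g, e), he.symm⟩, rfl⟩
  let Ph : Subgroup Gh := P.comap π
  have hmem : ∀ x : Ph, x.1.1.2 * (ψ ⟨x.1.1.1, x.2⟩)⁻¹ ∈ Z := by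
    intro x
    have h1 := hGh x.1
    have h2 := hφ ⟨x.1.1.1, x.2⟩
    rw [← QuotientGroup.ker_mk' Z, MonoidHom.mem_ker, map_mul, map_inv, ← h1, ← h2]
    simp
  let χ : Ph →* Z :=
    { toFun := fun x => ⟨x.1.1.2 * (ψ ⟨x.1.1.1, x.2⟩)⁻¹, hmem x⟩
      map_one' := by
        apply Subtype.ext
        have : ψ ⟨((1 : Ph).1.1.1 : G), (1 : Ph).2⟩ = 1 := map_one ψ
        simp only [this]; simp
      map_mul' := by
        intro x y
        apply Subtype.ext
        have : ψ ⟨((x * y : Ph).1.1.1 : G), (x * y).2⟩ =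
          ψ ⟨x.1.1.1, x.2⟩ * ψ ⟨y.1.1.1, y.2⟩ := by rw [← map_mul]; rfl
        simp only [this]
        have h := hc ⟨_, hmem y⟩ x.1.1.2
        simp only at h
        change x.1.1.2 * y.1.1.2 * _ = x.1.1.2 * _ * (y.1.1.2 * _)
        rw [mul_inv_rev]
        have h' := hc ⟨_, hmem y⟩ (ψ ⟨x.1.1.1, x.2⟩)⁻¹
        simp only at h'
        rw [mul_assoc x.1.1.2 _ (y.1.1.2 * _), h']
        group }
  let τ : Gh →* Z := χ.transfer
  have hτ : ∀ x : Gh, (x.1.1 = 1) → (τ x : E) = x.1.2 := by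
    intro x hx
    have hxZ : x.1.2 ∈ Z := by
      have := hGh x
      rw [hx, map_one] at this
      rw [← QuotientGroup.ker_mk' Z, MonoidHom.mem_ker, ← this]
    have hcen : ∀ y : Gh, y⁻¹ * x * y = x := by
      intro y
      apply Subtype.ext
      apply Prod.ext
      · change y.1.1⁻¹ * x.1.1 * y.1.1 = x.1.1
        rw [hx]; simp
      · change y.1.2⁻¹ * x.1.2 * y.1.2 = x.1.2
        have := hc ⟨_, hxZ⟩ y.1.2
        simp only at this
        rw [mul_assoc, ← this]; simp
    have hcen' : ∀ (k : ℕ) (y : Gh), y⁻¹ * x ^ k * y = x ^ k := by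
      intro k y
      have := conj_pow (i := k) (a := y⁻¹) (b := x)
      rw [inv_inv, hcen] at this
      exact this.symm
    have := MonoidHom.transfer_eq_pow χ x (fun k y _ => hcen' k y)
    have hidx : Ph.index = P.index := Subgroup.index_comap_of_surjective _ hπ
    have hP : x ∈ Ph := by change x.1.1 ∈ P; rw [hx]; exact one_mem P
    have h3 : χ ⟨x, hP⟩ ^ Ph.index = τ x := by
      rw [← map_pow, this]; rfl
    have h4 : (χ ⟨x, hP⟩ : E) = x.1.2 := by
      change x.1.2 * (ψ ⟨x.1.1, _⟩)⁻¹ = _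
      have : ψ ⟨x.1.1, hP⟩ = 1 := by
        have : (⟨x.1.1, hP⟩ : P) = 1 := Subtype.ext hx
        rw [this, map_one]
      rw [this]; simp
    rw [← h3, hidx]
    obtain ⟨m, hm⟩ := hodd
    rw [hm, pow_succ, pow_mul, hsq, one_pow, one_mul, h4]
  let Φ : Gh →* E :=
    { toFun := fun x => x.1.2 * ((τ x)⁻¹ : Z)
      map_one' := by simp
      map_mul' := by
        intro x y
        rw [map_mul, mul_inv]
        change x.1.2 * y.1.2 * ((((τ x)⁻¹ : Z) : E) * (((τ y)⁻¹ : Z) : E)) = _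
        have := hc (τ x)⁻¹ y.1.2
        rw [mul_assoc, ← mul_assoc y.1.2, this]
        group }
  have hker : π.ker ≤ Φ.ker := by
    intro x hx
    have hx : x.1.1 = 1 := hx
    change x.1.2 * ((τ x)⁻¹ : Z) = 1
    rw [← hτ x hx]; simp
  let Ψ0 : G →* E := π.liftOfRightInverse _ (Function.rightInverse_surjInv hπ) ⟨Φ, hker⟩
  have hΨ0 : ∀ x, Ψ0 (π x) = Φ x := fun x =>
    π.liftOfRightInverse_comp_apply _ (Function.rightInverse_surjInv hπ) ⟨Φ, hker⟩ x
  let s : P →* Gh := 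
    { toFun := fun p => ⟨(p, ψ p), hφ p⟩
      map_one' := by apply Subtype.ext; simp
      map_mul' := by intro x y; apply Subtype.ext; simp }
  obtain ⟨D, hD⟩ := hE' (τ.comp s)
  refine ⟨{ toFun := fun g => Ψ0 g * D g, map_one' := by simp, map_mul' := ?_ }, ?_⟩
  · intro x y
    rw [map_mul, map_mul]
    have := hc (D x) (Ψ0 y)
    change _ * ((D x : E) * (D y : E)) = _
    rw [mul_assoc, ← mul_assoc (Ψ0 y), this]
    group
  · intro p
    change Ψ0 p * D p = ψ p
    rw [hD]
    have := hΨ0 (s p)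
    change Ψ0 p = ψ p * ((τ (s p))⁻¹ : Z) at this
    rw [this]; simp

theorem lift_all (G : Type) [Group G] [Finite G] (P : Subgroup G) (hodd : Odd P.index)
    (hE : ∀ δ : P →* ℤˣ, ∃ D : G →* ℤˣ, ∀ p : P, D p = δ p) (n : ℕ) :
    ∀ (E : Type) [Group E] [Finite E] (_ : IsPGroup 2 E) (_ : Nat.card E = n) (ψ : P →* E),
    ∃ Ψ : G →* E, ∀ p : P, Ψ p = ψ p := by
  induction n using Nat.strong_induction_on with
  | _ n ih =>
  intro E _ _ hp hn ψ
  have : Fact (Nat.Prime 2) := ⟨Nat.prime_two⟩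
  rcases subsingleton_or_nontrivial E with hs | hs
  · exact ⟨1, fun p => Subsingleton.elim _ _⟩
  have hnt : Nontrivial (Subgroup.center E) := hp.center_nontrivial
  have hd : 2 ∣ Nat.card (Subgroup.center E) :=
    (hp.to_subgroup _).card_eq_or_dvd.resolve_left (by have := Finite.one_lt_card (α := Subgroup.center E); omega)
  obtain ⟨z, hz⟩ := exists_prime_orderOf_dvd_card' 2 hd
  let Z : Subgroup E := Subgroup.zpowers (z : E)
  have hZ : Z ≤ Subgroup.center E := by
    rw [Subgroup.zpowers_le]; exact z.2
  have hZ2 : Nat.card Z = 2 := by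
    rw [Nat.card_zpowers, Subgroup.orderOf_coe, hz]
  have : Z.Normal := ⟨fun a ha g => by
    have := Subgroup.mem_center_iff.1 (hZ ha) g
    rw [this]; simpa using ha⟩
  have hcard := Subgroup.card_eq_card_quotient_mul_card_subgroup Z
  have hpos : 0 < Nat.card (E ⧸ Z) := Nat.card_pos
  obtain ⟨φ, hφ⟩ := ih (Nat.card (E ⧸ Z)) (by rw [← hn]; rw [hZ2] at hcard; omega) (E ⧸ Z)
    (hp.to_quotient Z) rfl ((QuotientGroup.mk' Z).comp ψ)
  exact lift_central G P hodd hE E Z hZ hZ2 φ ψ hφ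

theorem compl_of_ext (G : Type) [Group G] [Finite G] (P : Sylow 2 G) 
    (hE : ∀ δ : P →* ℤˣ, ∃ D : G →* ℤˣ, ∀ p : P, D p = δ p) :
    ∃ N : Subgroup G, ∃ _ : N.Normal, ¬ 2 ∣ Nat.card N ∧ IsPGroup 2 (G ⧸ N) := by
  have : Fact (Nat.Prime 2) := ⟨Nat.prime_two⟩
  have hodd : ¬ 2 ∣ (P : Subgroup G).index := P.not_dvd_index
  obtain ⟨Ψ, hΨ⟩ := lift_all G P (Nat.odd_iff.2 (by omega)) hE _ P P.2 rfl (MonoidHom.id P)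
  have hsurj : Function.Surjective Ψ := fun p => ⟨p, hΨ p⟩
  have e : G ⧸ Ψ.ker ≃* P := QuotientGroup.quotientKerEquivOfSurjective Ψ hsurj
  refine ⟨Ψ.ker, inferInstance, ?_, P.2.of_equiv e.symm⟩
  have h1 := Subgroup.card_eq_card_quotient_mul_card_subgroup Ψ.ker
  have h2 := Subgroup.card_mul_index (P : Subgroup G)
  rw [Nat.card_congr e.toEquiv, ← h2] at h1
  have h3 := Nat.eq_of_mul_eq_mul_left Nat.card_pos h1
  rw [← h3]; exact hodd

theorem odd_root (f : Polynomial ℝ) (hm : f.Monic) (hodd : Odd f.natDegree) :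
    ∃ x, f.IsRoot x := by
  have hpos : 0 < f.degree := Polynomial.natDegree_pos_iff_degree_pos.1 hodd.pos
  have h1 : Filter.Tendsto (fun x => f.eval x) Filter.atTop Filter.atTop :=
    f.tendsto_atTop_of_leadingCoeff_nonneg hpos (by rw [hm.leadingCoeff]; exact zero_le_one)
  have hnd : (f.comp (-Polynomial.X)).natDegree = f.natDegree := by
    rw [Polynomial.natDegree_comp]; simp
  have h2 : Filter.Tendsto (fun x => (f.comp (-Polynomial.X)).eval x) Filter.atTop
      Filter.atBot := by
    apply Polynomial.tendsto_atBot_of_leadingCoeff_nonpos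
    · apply Polynomial.natDegree_pos_iff_degree_pos.1
      rw [hnd]; exact hodd.pos
    · rw [Polynomial.leadingCoeff_comp (by simp), hm.leadingCoeff]
      simp [hodd.neg_one_pow]
  obtain ⟨a, ha⟩ := (h1.eventually_ge_atTop 0).exists
  obtain ⟨b, hb⟩ := (h2.eventually_le_atBot 0).exists
  rw [Polynomial.eval_comp] at hb
  obtain ⟨x, hx⟩ := mem_range_of_exists_le_of_exists_ge f.continuous ⟨_, hb⟩ ⟨a, ha⟩
  exact ⟨x, hx⟩

theorem abs_irr (G : Type) [Group G] [Fintype G] (V : Type) [AddCommGroup V] [Module ℝ V]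
    [FiniteDimensional ℝ V] (ρ : Representation ℝ G V) (hodd : Odd (finrank ℝ V))
    (hmin : ∀ W : Submodule ℝ V, (∀ g, ∀ w ∈ W, ρ g w ∈ W) → Odd (finrank ℝ W) → W = ⊤) :
    ∑ g : G, ρ.character g * ρ.character g⁻¹ = Nat.card G := by
  have hne : (Nat.card G : ℝ) ≠ 0 := by
    have : 0 < Nat.card G := Nat.card_pos
    positivity
  have := invertibleOfNonzero hne
  have key := Representation.card_inv_mul_sum_char_mul_char_eq_finrank ρ ρ
  have h1 : finrank ℝ (Representation.IntertwiningMap ρ ρ) = 1 := by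
    have hV : Nontrivial V := Module.nontrivial_of_finrank_pos (R := ℝ) hodd.pos
    let i0 : Representation.IntertwiningMap ρ ρ := ⟨LinearMap.id, fun g => rfl⟩
    apply finrank_eq_one i0
    · intro h
      obtain ⟨v, hv⟩ := exists_ne (0 : V)
      have := congrArg (fun f : Representation.IntertwiningMap ρ ρ => f.toLinearMap v) h
      exact hv this
    · intro T
      have hT : ∀ g v, T.toLinearMap (ρ g v) = ρ g (T.toLinearMap v) := fun g v =>
        LinearMap.congr_fun (T.isIntertwining' g) v
      obtain ⟨c, hc⟩ := odd_root (T.toLinearMap.charpoly) (LinearMap.charpoly_monic _)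
        (by rw [LinearMap.charpoly_natDegree]; exact hodd)
      refine ⟨c, ?_⟩
      let S : V →ₗ[ℝ] V := T.toLinearMap - c • LinearMap.id
      have hS : ∀ g v, S (ρ g v) = ρ g (S v) := by
        intro g v; simp [S, hT]
      have hker : S.ker ≠ ⊥ := by
        rw [← Module.End.hasEigenvalue_iff_isRoot_charpoly] at hc
        obtain ⟨v, hv⟩ := hc.exists_hasEigenvector
        intro hb
        have : v ∈ S.ker := by
          rw [LinearMap.mem_ker]; simp [S, hv.apply_eq_smul]
        rw [hb] at this
        exact hv.2 this
      have hsum := LinearMap.finrank_range_add_finrank_ker S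
      have hkertop : S.ker = ⊤ := by
        by_cases hk : Odd (finrank ℝ S.ker)
        · apply hmin _ _ hk
          intro g w hw
          rw [LinearMap.mem_ker] at hw ⊢
          rw [hS, hw, map_zero]
        · exfalso
          have hr : Odd (finrank ℝ S.range) := by
            rw [← hsum] at hodd
            rw [Nat.not_odd_iff_even] at hk
            exact (Nat.odd_add.1 hodd).2 hk
          have := hmin S.range (by
            rintro g w ⟨v, rfl⟩
            exact ⟨ρ g v, hS g v⟩) hr
          rw [this, finrank_top] at hsum
          apply hker
          apply Submodule.finrank_eq_zero.1
          omega
      apply Representation.IntertwiningMap.ext_iff.mpr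
      have h0 : S = 0 := LinearMap.ker_eq_top.1 hkertop
      ext v
      have := LinearMap.congr_fun h0 v
      simp only [S, LinearMap.sub_apply, LinearMap.smul_apply, LinearMap.id_apply,
        LinearMap.zero_apply, sub_eq_zero] at this
      exact this.symm
  rw [h1, inv_mul_eq_iff_eq_mul₀ hne] at key
  simpa using key

theorem real_char_mem (G : Type) [Group G] [Fintype G] (V : Type) [AddCommGroup V] [Module ℝ V]
    [FiniteDimensional ℝ V] (ρ : Representation ℝ G V) (hodd : Odd (finrank ℝ V))
    (hn : ∑ g : G, ρ.character g * ρ.character g⁻¹ = Nat.card G) :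
    (fun g => ((ρ.character g : ℝ) : ℂ)) ∈ IrrFieldP' 2 G realSubfield := by
  let ρC : Representation ℂ G (TensorProduct ℝ ℂ V) :=
    { toFun := fun g => (ρ g).baseChange ℂ
      map_one' := by rw [map_one]; exact LinearMap.baseChange_id
      map_mul' := fun g h => by rw [map_mul]; exact LinearMap.baseChange_comp _ _ }
  have hch : ∀ g, (FDRep.of ρC).character g = ((ρ.character g : ℝ) : ℂ) := fun g => by
    change LinearMap.trace ℂ _ ((ρ g).baseChange ℂ) = _
    rw [LinearMap.trace_baseChange]; rfl
  refine ⟨⟨finrank ℝ V, ⟨FDRep.of ρC, ?_, ?_, ?_⟩, ?_⟩, fun g => ⟨_, rfl⟩⟩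
  · rw [FDRep.simple_iff_char_is_norm_one]
    simp only [hch]
    exact_mod_cast congrArg (fun x : ℝ => (x : ℂ)) hn
  · ext g; rw [hch]
  · exact Module.finrank_baseChange
  · exact hodd.not_two_dvd_nat

theorem hom_extends (G : Type) [Group G] [Finite G] (P : Subgroup G) (hodd : Odd P.index)
    (hlin : ∀ χ ∈ IrrFieldP' 2 G realSubfield, χ 1 = 1) (δ : P →* ℤˣ) :
    ∃ D : G →* ℤˣ, ∀ p : P, D p = δ p := by
  have := Fintype.ofFinite G
  let ρ : Representation ℝ G (G → ℝ) :=
    { toFun := fun g => LinearMap.funLeft ℝ ℝ (fun x => g⁻¹ * x)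
      map_one' := by ext; simp [LinearMap.funLeft]
      map_mul' := fun g h => by
        apply LinearMap.ext; intro f; ext x; simp [LinearMap.funLeft, mul_assoc] }
  have hρ : ∀ g f x, ρ g f x = f (g⁻¹ * x) := fun _ _ _ => rfl
  let W : Submodule ℝ (G → ℝ) :=
    { carrier := {f | ∀ (g : G) (p : P), f (g * p) = ((δ p : ℤ) : ℝ) * f g}
      zero_mem' := by intro g p; simp
      add_mem' := by
        intro a b ha hb g p
        simp only [Pi.add_apply, ha g p, hb g p, mul_add]
      smul_mem' := by
        intro c a ha g p
        simp only [Pi.smul_apply, ha g p, smul_eq_mul]; ring }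
  have hWinv : ∀ g, ∀ w ∈ W, ρ g w ∈ W := by
    intro g w hw x p
    rw [hρ, hρ, ← mul_assoc, hw]
  have hWfin : finrank ℝ W = P.index := by
    have hmem : ∀ g : G, (g : G ⧸ P).out⁻¹ * g ∈ P := fun g => by
      rw [← QuotientGroup.eq]; simp
    let e : W ≃ₗ[ℝ] (G ⧸ P → ℝ) :=
      { toFun := fun f q => f.1 q.out
        map_add' := fun _ _ => rfl
        map_smul' := fun _ _ => rfl
        invFun := fun h => ⟨fun g => ((δ ⟨_, hmem g⟩ : ℤ) : ℝ) * h g, by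
          intro g p
          have hq : ((g * p : G) : G ⧸ P) = (g : G ⧸ P) := by simp
          have : (⟨_, hmem (g * p)⟩ : P) = ⟨_, hmem g⟩ * p := by
            apply Subtype.ext; simp [mul_assoc]
          beta_reduce
          rw [this, map_mul, hq]; push_cast; ring⟩
        left_inv := by
          intro f
          apply Subtype.ext
          ext g
          change ((δ ⟨_, hmem g⟩ : ℤ) : ℝ) * f.1 (g : G ⧸ P).out = f.1 g
          rw [← f.2]; simp
        right_inv := by
          intro h
          ext q
          change ((δ ⟨_, hmem q.out⟩ : ℤ) : ℝ) * h (q.out : G ⧸ P) = h q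
          have : (⟨_, hmem q.out⟩ : P) = 1 := by apply Subtype.ext; simp
          rw [this]; simp }
    have := Fintype.ofFinite (G ⧸ P)
    rw [e.finrank_eq, Module.finrank_pi, ← Nat.card_eq_fintype_card]; rfl
  classical
  have hex : ∃ n, Odd n ∧ ∃ U : Submodule ℝ (G → ℝ), U ≤ W ∧ (∀ g, ∀ w ∈ U, ρ g w ∈ U) ∧
      finrank ℝ U = n := ⟨_, hWfin ▸ hodd, W, le_rfl, hWinv, rfl⟩
  obtain ⟨hnodd, U, hUW, hUinv, hUn⟩ := Nat.find_spec hex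
  have hnmin := fun m => Nat.find_min' hex (m := m)
  rw [← hUn] at hnodd
  rw [← hUn] at hnmin
  let ρU : Representation ℝ G U :=
    { toFun := fun g => (ρ g).restrict (hUinv g)
      map_one' := by ext; simp
      map_mul' := fun g h => by ext; simp }
  have hnorm := abs_irr G U ρU hnodd (by
    intro W' hinv hW'
    apply Submodule.eq_top_of_finrank_eq
    apply le_antisymm (Submodule.finrank_le _)
    apply hnmin
    refine ⟨hW', W'.map U.subtype, ?_, ?_, ?_⟩
    · exact (Submodule.map_subtype_le _ _).trans hUW
    · rintro g _ ⟨w, hw, rfl⟩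
      exact ⟨ρU g w, hinv g w hw, rfl⟩
    · exact Submodule.finrank_map_subtype_eq _ _)
  have h1 := hlin _ (real_char_mem G U ρU hnodd hnorm)
  have hU1 : finrank ℝ U = 1 := by
    simp only [Representation.char_one] at h1
    exact_mod_cast h1
  obtain ⟨f, hf0, hf⟩ := finrank_eq_one_iff'.1 hU1
  have hc : ∀ g, ∃ c : ℝ, ∀ x, f.1 (g⁻¹ * x) = c * f.1 x := by
    intro g
    obtain ⟨c, hc⟩ := hf (ρU g f)
    refine ⟨c, fun x => ?_⟩
    have := congrArg (fun u : U => u.1 x) hc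
    exact this.symm
  choose c hc using hc
  have hf1 : f.1 1 ≠ 0 := by
    intro h0
    apply hf0
    apply Subtype.ext
    ext x
    have := hc x⁻¹ 1
    simpa [h0] using this
  let d : G → ℝ := fun g => c g⁻¹
  have hd : ∀ g x, f.1 (g * x) = d g * f.1 x := fun g x => by
    have := hc g⁻¹ x
    rwa [inv_inv] at this
  have hd1 : d 1 = 1 := by
    have := hd 1 1
    rw [one_mul] at this
    exact (mul_right_cancel₀ hf1 (by rw [← this, one_mul]))
  have hdm : ∀ g h, d (g * h) = d g * d h := by
    intro g h
    apply mul_right_cancel₀ hf1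
    rw [← hd, mul_assoc, hd, hd, mul_assoc]
  let dh : G →* ℝ := ⟨⟨d, hd1⟩, hdm⟩
  have hpm : ∀ g, d g = 1 ∨ d g = -1 := by
    intro g
    have h : dh g ^ Nat.card G = 1 := by rw [← map_pow, pow_card_eq_one', map_one]
    have hab : |d g| = 1 := (pow_eq_one_iff_of_nonneg (abs_nonneg _) Nat.card_pos.ne').1
      (by rw [← abs_pow]; change |dh g ^ _| = 1; rw [h, abs_one])
    exact eq_or_eq_neg_of_abs_eq hab
  have hdp : ∀ p : P, d p = ((δ p : ℤ) : ℝ) := by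
    intro p
    apply mul_right_cancel₀ hf1
    rw [← hd, ← hUW f.2 1 p, one_mul, mul_one]
  have hne : (-1 : ℝ) ≠ 1 := by norm_num
  refine ⟨{ toFun := fun g => if d g = 1 then 1 else -1, map_one' := by simp [hd1],
            map_mul' := ?_ }, ?_⟩
  · intro g h
    rw [hdm]
    rcases hpm g with h1 | h1 <;> rcases hpm h with h2 | h2 <;> simp [h1, h2, hne]
  · intro p
    change (if d p = 1 then 1 else -1) = δ p
    rw [hdp]
    rcases Int.units_eq_one_or (δ p) with h | h <;> simp [h, hne]

theorem irr_orth (G : Type) [Group G] [Fintype G] (V W : FDRep ℂ G) [Simple V] [Simple W]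
    (h : ¬ Nonempty (V ≅ W)) : ∑ g : G, V.character g * W.character g⁻¹ = 0 := by
  have hne : (Nat.card G : ℂ) ≠ 0 := by
    have : 0 < Nat.card G := Nat.card_pos
    exact_mod_cast this.ne'
  have := invertibleOfNonzero hne
  have key := FDRep.char_orthonormal V W
  rw [if_neg h] at key
  simpa [hne] using key

theorem irr_finite (G : Type) [Group G] [Finite G] : {χ : G → ℂ | IsIrrChar G χ}.Finite := by
  have := Fintype.ofFinite G
  have hne : (Nat.card G : ℂ) ≠ 0 := by
    have : 0 < Nat.card G := Nat.card_pos
    exact_mod_cast this.ne'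
  have hli : LinearIndependent ℂ (fun χ : {χ : G → ℂ | IsIrrChar G χ} => (χ : G → ℂ)) := by
    rw [linearIndependent_iff']
    intro s a hs χ hχ
    obtain ⟨d, V, hV, hVχ, hd⟩ := χ.2
    have h0 : ∑ g : G, (∑ ψ ∈ s, a ψ • (ψ : G → ℂ)) g * χ.1 g⁻¹ = 0 := by rw [hs]; simp
    simp only [Finset.sum_apply, Pi.smul_apply, smul_eq_mul, Finset.sum_mul] at h0
    rw [Finset.sum_comm, Finset.sum_eq_single_of_mem χ hχ] at h0
    · have hn := (FDRep.simple_iff_char_is_norm_one V).1 hV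
      simp only [mul_assoc, ← Finset.mul_sum] at h0
      rw [hVχ, hn] at h0
      exact (mul_eq_zero.1 h0).resolve_right hne
    · intro ψ _ hψ
      obtain ⟨d', V', hV', hVψ, hd'⟩ := ψ.2
      simp only [mul_assoc, ← Finset.mul_sum]
      rw [hVχ, hVψ, irr_orth G V' V, mul_zero]
      rintro ⟨i⟩
      apply hψ
      apply Subtype.ext
      rw [hVχ, hVψ, FDRep.char_iso i]
  exact hli.setFinite

theorem lin_aux (V : Type) [AddCommGroup V] [Module ℂ V] (h : finrank ℂ V = 1)
    (A B : V →ₗ[ℂ] V) :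
    LinearMap.trace ℂ V (A * B) = LinearMap.trace ℂ V A * LinearMap.trace ℂ V B := by
  obtain ⟨a, ha, -⟩ := LinearMap.existsUnique_eq_smul_id_of_finrank_eq_one h A
  obtain ⟨b, hb, -⟩ := LinearMap.existsUnique_eq_smul_id_of_finrank_eq_one h B
  have : FiniteDimensional ℂ V := Module.finite_of_finrank_eq_succ h
  rw [ha, hb, ← Module.End.one_eq_id, smul_mul_smul_comm, map_smul, map_smul, map_smul, mul_one,
    LinearMap.trace_one, h]
  simp

theorem lin_mul (G : Type) [Group G] (V : FDRep ℂ G) (h : finrank ℂ V = 1) (g g' : G) :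
    V.character (g * g') = V.character g * V.character g' := by
  simp only [FDRep.character, map_mul]
  exact lin_aux V h _ _

def twistRep (G : Type) [Group G] (V : FDRep ℂ G) (l : G →* ℂ) : Representation ℂ G V :=
  { toFun := fun g => l g • V.ρ g
    map_one' := by simp
    map_mul' := fun g h => by rw [map_mul, map_mul, smul_mul_smul_comm] }

theorem twist_char (G : Type) [Group G] (V : FDRep ℂ G) (l : G →* ℂ) (g : G) :
    (FDRep.of (twistRep G V l)).character g = l g * V.character g := by
  change LinearMap.trace ℂ V (l g • V.ρ g) = _
  rw [map_smul]; rfl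

theorem twist_simple (G : Type) [Group G] [Fintype G] (V : FDRep ℂ G) [hV : Simple V]
    (l : G →* ℂ) : Simple (FDRep.of (twistRep G V l)) := by
  rw [FDRep.simple_iff_char_is_norm_one] at hV ⊢
  simp only [twist_char]
  rw [← hV]
  apply Finset.sum_congr rfl
  intro g _
  have : l g * l g⁻¹ = 1 := by rw [← map_mul, mul_inv_cancel, map_one]
  linear_combination V.character g * V.character g⁻¹ * this

theorem twist_inj (G : Type) [Group G] [Fintype G] (V : FDRep ℂ G) [Simple V]
    (hodd : Odd (finrank ℂ V)) (l m : G →* ℂ) (hl : ∀ g, l g ∈ realSubfield)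
    (hm : ∀ g, m g ∈ realSubfield)
    (h : ∀ g, l g * V.character g = m g * V.character g) : ∀ g, l g = m g := by
  have hs1 := twist_simple G V l
  have hs2 := twist_simple G V m
  have hiso : Nonempty (FDRep.of (twistRep G V l) ≅ FDRep.of (twistRep G V m)) := by
    by_contra hno
    have h0 := irr_orth G _ _ hno
    have hn := (FDRep.simple_iff_char_is_norm_one _).1 hs1
    simp only [twist_char, h] at h0 hn
    rw [h0] at hn
    have : 0 < Nat.card G := Nat.card_pos
    exact this.ne (by exact_mod_cast hn)
  obtain ⟨i⟩ := hiso
  intro g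
  have hc := FDRep.Iso.conj_ρ i g
  have hdet := congrArg LinearMap.det hc
  rw [LinearEquiv.conj_apply, LinearMap.comp_assoc, LinearMap.det_conj] at hdet
  change LinearMap.det (m g • V.ρ g) = LinearMap.det (l g • V.ρ g) at hdet
  rw [LinearMap.det_smul, LinearMap.det_smul] at hdet
  have hu : LinearMap.det (V.ρ g) ≠ 0 := by
    intro h0
    have : LinearMap.det (V.ρ g * V.ρ g⁻¹) = 1 := by
      rw [← map_mul, mul_inv_cancel, map_one, map_one]
    rw [map_mul, h0, zero_mul] at this
    exact zero_ne_one this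
  have hp := mul_right_cancel₀ hu hdet
  obtain ⟨x, hx⟩ := hl g
  obtain ⟨y, hy⟩ := hm g
  rw [← hx, ← hy] at hp ⊢
  have hp' : y ^ finrank ℂ V = x ^ finrank ℂ V := by
    apply Complex.ofReal_injective
    push_cast
    exact hp
  rw [hodd.strictMono_pow.injective hp']

theorem deg_of_mem (G : Type) [Group G] (χ : G → ℂ) (h : χ ∈ IrrFieldP' 2 G realSubfield) :
    ∃ V : FDRep ℂ G, Simple V ∧ χ = V.character ∧ Odd (finrank ℂ V) ∧
      χ 1 = (finrank ℂ V : ℂ) := by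
  obtain ⟨⟨d, ⟨V, hV, hχ, hd⟩, hd2⟩, -⟩ := h
  refine ⟨V, hV, hχ, ?_, ?_⟩
  · rw [hd, Nat.odd_iff]; omega
  · rw [hχ, FDRep.char_one]

theorem all_linear (G : Type) [Group G] [Finite G] (h : acdFieldP' 2 G realSubfield < 3 / 2) :
    ∀ χ ∈ IrrFieldP' 2 G realSubfield, χ 1 = 1 := by
  by_contra hcon
  push Not at hcon
  obtain ⟨χ, hχ, hχ1⟩ := hcon
  have := Fintype.ofFinite G
  classical
  set S := IrrFieldP' 2 G realSubfield with hSdef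
  have hfin : S.Finite := (irr_finite G).subset (by
    rintro ψ ⟨⟨d, hd, -⟩, -⟩; exact ⟨d, hd⟩)
  let T := hfin.toFinset
  have hT : ∀ ψ, ψ ∈ T ↔ ψ ∈ S := fun ψ => hfin.mem_toFinset
  let L := T.filter (fun ψ => ψ 1 = 1)
  let B := T.filter (fun ψ => ¬ ψ 1 = 1)
  have hcard : L.card + B.card = T.card := Finset.card_filter_add_card_filter_not _
  obtain ⟨V, hV, hVχ, hodd, hdeg⟩ := deg_of_mem G χ hχ
  have hlin : ∀ ψ ∈ L, ∃ l : G →* ℂ, ∀ g, l g = ψ g := by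
    intro ψ hψ
    obtain ⟨hψT, hψ1⟩ := Finset.mem_filter.1 hψ
    obtain ⟨W, hW, hWψ, -, hWd⟩ := deg_of_mem G ψ ((hT ψ).1 hψT)
    have h1 : finrank ℂ W = 1 := by
      rw [hψ1] at hWd; exact_mod_cast hWd.symm
    refine ⟨⟨⟨ψ, hψ1⟩, fun a b => ?_⟩, fun g => rfl⟩
    change ψ (a * b) = ψ a * ψ b
    rw [hWψ]; exact lin_mul G W h1 a b
  have hreal : ∀ ψ ∈ L, ∀ g, ψ g ∈ realSubfield := by
    intro ψ hψ
    exact ((hT ψ).1 (Finset.mem_filter.1 hψ).1).2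
  have hLB : L.card ≤ B.card := by
    apply Finset.card_le_card_of_injOn (fun ψ => ψ * χ)
    · intro ψ hψ
      have hψ : ψ ∈ L := hψ
      obtain ⟨l, hl⟩ := hlin ψ hψ
      have hψ1 := (Finset.mem_filter.1 hψ).2
      refine Finset.mem_coe.2 (Finset.mem_filter.2 ⟨(hT _).2 ⟨⟨finrank ℂ V,
        ⟨FDRep.of (twistRep G V l), twist_simple G V l, ?_, rfl⟩, ?_⟩, ?_⟩, ?_⟩)
      · ext g
        rw [twist_char, hl, ← hVχ]; rfl
      · exact hodd.not_two_dvd_nat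
      · intro g
        exact mul_mem (hreal ψ hψ g) (hχ.2 g)
      · simpa [hψ1] using hχ1
    · intro ψ hψ ψ' hψ' heq
      have hψ : ψ ∈ L := hψ
      have hψ' : ψ' ∈ L := hψ'
      obtain ⟨l, hl⟩ := hlin ψ hψ
      obtain ⟨m, hm⟩ := hlin ψ' hψ'
      ext g
      rw [← hl, ← hm]
      refine twist_inj G V hodd l m ?_ ?_ ?_ g
      · intro g; rw [hl]; exact hreal ψ hψ g
      · intro g; rw [hm]; exact hreal ψ' hψ' g
      · intro g
        rw [hl, hm, ← hVχ]
        exact congrFun heq g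
  have hsum : ∑ᶠ ψ ∈ S, (ψ 1).re = ∑ ψ ∈ T, (ψ 1).re :=
    finsum_mem_eq_finite_toFinset_sum _ hfin
  have hn : S.ncard = T.card := Set.ncard_eq_toFinset_card _ hfin
  have hsplit : ∑ ψ ∈ L, (ψ 1).re + ∑ ψ ∈ B, (ψ 1).re = ∑ ψ ∈ T, (ψ 1).re :=
    Finset.sum_filter_add_sum_filter_not _ _ _
  have hL : (L.card : ℝ) ≤ ∑ ψ ∈ L, (ψ 1).re := by
    rw [Finset.sum_congr rfl (g := fun _ => (1 : ℝ))]
    · simp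
    · intro ψ hψ
      rw [(Finset.mem_filter.1 hψ).2]; simp
  have hB : (B.card : ℝ) * 3 ≤ ∑ ψ ∈ B, (ψ 1).re := by
    rw [← nsmul_eq_mul]
    apply Finset.card_nsmul_le_sum
    intro ψ hψ
    obtain ⟨hψT, hψ1⟩ := Finset.mem_filter.1 hψ
    obtain ⟨W, hW, hWψ, ho, hWd⟩ := deg_of_mem G ψ ((hT ψ).1 hψT)
    rw [hWd] at hψ1 ⊢
    have h1 : finrank ℂ W ≠ 1 := by
      intro h; apply hψ1; rw [h]; simp
    have h3 : 3 ≤ finrank ℂ W := by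
      obtain ⟨k, hk⟩ := ho; omega
    rw [Complex.natCast_re]
    exact_mod_cast h3
  have hpos : 0 < T.card := Finset.card_pos.2 ⟨χ, (hT χ).2 hχ⟩
  unfold acdFieldP' at h
  rw [← hSdef, hsum, hn, div_lt_iff₀ (by exact_mod_cast hpos), ← hsplit, ← hcard] at h
  push_cast at h
  have hLB' : (L.card : ℝ) ≤ B.card := by exact_mod_cast hLB
  linarith [(Nat.cast_nonneg L.card : (0 : ℝ) ≤ L.card),
    (by exact_mod_cast hcard ▸ hpos : (0 : ℝ) < (L.card : ℝ) + B.card)]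

/-- Corollary 1.4(iii): if `acd_{ℝ,2'}(G) < 3/2` then `G` has a normal `2`-complement. -/
theorem acd_real_two_prime_lt_three_halves_normal_two_complement
    (G : Type) [Group G] [Finite G] (h : acdFieldP' 2 G realSubfield < 3 / 2) :
    ∃ N : Subgroup G, ∃ _ : N.Normal, ¬ 2 ∣ Nat.card N ∧ IsPGroup 2 (G ⧸ N) := by
  have hlin := all_linear G h
  have : Fact (Nat.Prime 2) := ⟨Nat.prime_two⟩
  obtain ⟨P⟩ : Nonempty (Sylow 2 G) := inferInstance
  have hidx : ¬ 2 ∣ (P : Subgroup G).index := P.not_dvd_index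
  exact compl_of_ext G P (hom_extends G P (Nat.odd_iff.2 (by omega)) hlin)
end
end
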